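/- arXiv:1104.3553 — 2 statements merged into one kernel-verified Lean document; each statement's English description precedes it below -/
import Mathlib

section
/- There exists a constant C > 0 with the following property. Let μ be a finite complex Borel measure on ℝ with ∫_ℝ log(1 + log(1 + |s|)) d|μ|(s) < ∞, let c₀ ∈ ℂ, and define f : ℝ → ℂ by f(t) = c₀ − ∫_ℝ φ_s(t) dμ(s), where φ_s(t) := ((|t| + |s|) − |t − s|)/2 (note |φ_s(t)| ≤ min(|s|, |t|), so the integral converges). Then for every δ > 0 and all bounded self-adjoint operators A, B on a complex Hilbert space with ‖A − B‖ ≤ δ, one has ‖f(A) − f(B)‖ ≤ C · δ · ∫_ℝ log(1 + log(1 + |s|/δ)) d|μ|(s). -/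
open MeasureTheory ENNReal

/-- `|T| = (T*T)^{1/2}` via the continuous functional calculus. -/
noncomputable def opAbs {H : Type} [NormedAddCommGroup H] [InnerProductSpace ℂ H]
    [CompleteSpace H] (T : H →L[ℂ] H) : H →L[ℂ] H :=
  cfc Real.sqrt (star T * T)

/-- The Hilbert space `ℓ²(ℕ, ℂ)`. -/
noncomputable abbrev ellTwo : Type := lp (fun _ : ℕ => ℂ) 2

/-- Application of a function `f : ℝ → ℂ` to a (self-adjoint) operator via the
continuous functional calculus. -/
noncomputable def cfcC {H : Type} [NormedAddCommGroup H] [InnerProductSpace ℂ H]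
    [CompleteSpace H] (f : ℝ → ℂ) (A : H →L[ℂ] H) : H →L[ℂ] H :=
  cfc (fun z : ℂ => f z.re) A

/-- φ_s(t) = ((|t| + |s|) − |t − s|)/2. -/
noncomputable def phi (s t : ℝ) : ℝ := ((|t| + |s|) - |t - s|) / 2

section DiagonalWeights

set_option linter.unusedSectionVars false

open scoped Matrix.Norms.L2Operator

variable {m n : Type*} [Fintype m] [Fintype n] [DecidableEq m] [DecidableEq n]

/-- The complex diagonal matrix with prescribed real diagonal. -/
noncomputable def realDiag (x : m → ℝ) : Matrix m m ℂ := Matrix.diagonal fun i => (x i : ℂ)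

lemma realDiag_mul_apply (x : m → ℝ) (X : Matrix m n ℂ) (i : m) (j : n) :
    (realDiag x * X) i j = x i * X i j := by
  simp [realDiag]

lemma mul_realDiag_apply (y : n → ℝ) (X : Matrix m n ℂ) (i : m) (j : n) :
    (X * realDiag y) i j = X i j * y j := by
  simp [realDiag]

lemma norm_realDiag_le {x : m → ℝ} {K : ℝ} (hK : 0 ≤ K) (h : ∀ i, |x i| ≤ K) :
    ‖realDiag x‖ ≤ K := by
  rw [realDiag, Matrix.l2_opNorm_diagonal, pi_norm_le_iff_of_nonneg hK]
  intro i
  simpa using h i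

lemma norm_realDiag_mul_le {x : m → ℝ} {X : Matrix m n ℂ} {K : ℝ} (hK : 0 ≤ K)
    (h : ∀ i j, X i j ≠ 0 → |x i| ≤ K) : ‖realDiag x * X‖ ≤ K * ‖X‖ := by
  classical
  have e : realDiag x * X = realDiag (fun i => if |x i| ≤ K then x i else 0) * X := by
    ext i j
    simp only [realDiag_mul_apply]
    by_cases hX : X i j = 0
    · simp [hX]
    · simp [h i j hX]
  rw [e]
  refine (Matrix.l2_opNorm_mul _ _).trans (mul_le_mul_of_nonneg_right ?_ (norm_nonneg _))
  refine norm_realDiag_le hK fun i => ?_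
  split_ifs with h'
  · exact h'
  · simpa using hK

lemma conjTranspose_realDiag (x : m → ℝ) : (realDiag x).conjTranspose = realDiag x := by
  rw [realDiag, Matrix.diagonal_conjTranspose]
  congr 1
  ext i
  simp

lemma norm_mul_realDiag_le {y : n → ℝ} {X : Matrix m n ℂ} {K : ℝ} (hK : 0 ≤ K)
    (h : ∀ i j, X i j ≠ 0 → |y j| ≤ K) : ‖X * realDiag y‖ ≤ K * ‖X‖ := by
  rw [← Matrix.l2_opNorm_conjTranspose, ← Matrix.l2_opNorm_conjTranspose X,
    Matrix.conjTranspose_mul, conjTranspose_realDiag]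
  exact norm_realDiag_mul_le hK fun j i hX => h i j (by simpa using hX)

/-- A lower bound for the Sylvester operator `X ↦ A X + X B` with diagonal coefficients. -/
lemma mul_norm_le_norm_sylvester {x : m → ℝ} {y : n → ℝ} {X : Matrix m n ℂ} {α β : ℝ}
    (h : ∀ i j, X i j ≠ 0 → α ≤ x i ∧ β ≤ y j) :
    (α + β) * ‖X‖ ≤ ‖realDiag x * X + X * realDiag y‖ := by
  obtain ⟨R₁, hR₁⟩ := (Set.finite_range x).bddAbove
  obtain ⟨R₂, hR₂⟩ := (Set.finite_range y).bddAbove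
  set R := max (max R₁ R₂) (max α β)
  have hx : ∀ i, x i ≤ R := fun i =>
    (hR₁ ⟨i, rfl⟩).trans ((le_max_left _ _).trans (le_max_left _ _))
  have hy : ∀ j, y j ≤ R := fun j =>
    (hR₂ ⟨j, rfl⟩).trans ((le_max_right _ _).trans (le_max_left _ _))
  have hα : α ≤ R := (le_max_left _ _).trans (le_max_right _ _)
  have hβ : β ≤ R := (le_max_right _ _).trans (le_max_right _ _)
  have e : ((2 * R : ℝ) : ℂ) • X = (realDiag x * X + X * realDiag y)
      + realDiag (fun i => R - x i) * X + X * realDiag (fun j => R - y j) := by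
    ext i j
    simp only [Matrix.add_apply, Matrix.smul_apply, realDiag_mul_apply, mul_realDiag_apply,
      smul_eq_mul]
    push_cast
    ring
  have h1 : ‖realDiag (fun i => R - x i) * X‖ ≤ (R - α) * ‖X‖ :=
    norm_realDiag_mul_le (by linarith) fun i j hX => by
      rw [abs_of_nonneg (by linarith [hx i])]
      linarith [(h i j hX).1]
  have h2 : ‖X * realDiag (fun j => R - y j)‖ ≤ (R - β) * ‖X‖ :=
    norm_mul_realDiag_le (by linarith) fun i j hX => by
      rw [abs_of_nonneg (by linarith [hy j])]
      linarith [(h i j hX).2]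
  have h3 : 2 * R * ‖X‖ ≤ ‖((2 * R : ℝ) : ℂ) • X‖ := by
    rw [norm_smul, Complex.norm_real]
    exact mul_le_mul_of_nonneg_right (le_abs_self _) (norm_nonneg _)
  rw [e] at h3
  have h4 := h3.trans (norm_add₃_le)
  linarith

open Classical in
/-- The matrix obtained from `X` by keeping the block of rows `p` and columns `q`. -/
noncomputable def blockPart (p : m → Prop) (q : n → Prop) (X : Matrix m n ℂ) : Matrix m n ℂ :=
  Matrix.of fun i j => if p i ∧ q j then X i j else 0

open Classical in
lemma blockPart_apply (p : m → Prop) (q : n → Prop) (X : Matrix m n ℂ) (i : m) (j : n) :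
    blockPart p q X i j = if p i ∧ q j then X i j else 0 := rfl

lemma of_blockPart_ne_zero {p : m → Prop} {q : n → Prop} {X : Matrix m n ℂ} {i : m} {j : n}
    (h : blockPart p q X i j ≠ 0) : p i ∧ q j ∧ X i j ≠ 0 := by
  rw [blockPart_apply] at h
  split_ifs at h with hpq
  · exact ⟨hpq.1, hpq.2, h⟩
  · exact absurd rfl h

open Classical in
lemma blockPart_eq (p : m → Prop) (q : n → Prop) (X : Matrix m n ℂ) :
    blockPart p q X = realDiag (fun i => if p i then 1 else 0) *
      (X * realDiag (fun j => if q j then 1 else 0)) := by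
  ext i j
  rw [blockPart_apply, realDiag_mul_apply, mul_realDiag_apply]
  by_cases hp : p i <;> by_cases hq : q j <;> simp [hp, hq]

lemma norm_blockPart_le (p : m → Prop) (q : n → Prop) (X : Matrix m n ℂ) :
    ‖blockPart p q X‖ ≤ ‖X‖ := by
  classical
  rw [blockPart_eq]
  refine (norm_realDiag_mul_le zero_le_one ?_).trans ?_
  · intro i _ _
    split_ifs <;> simp
  · rw [one_mul]
    refine (norm_mul_realDiag_le zero_le_one ?_).trans_eq (one_mul _)
    intro _ j _
    split_ifs <;> simp

lemma blockPart_sylvester (p : m → Prop) (q : n → Prop) (X : Matrix m n ℂ) (x : m → ℝ)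
    (y : n → ℝ) : realDiag x * blockPart p q X + blockPart p q X * realDiag y =
      blockPart p q (realDiag x * X + X * realDiag y) := by
  ext i j
  simp only [Matrix.add_apply, realDiag_mul_apply, mul_realDiag_apply, blockPart_apply]
  split_ifs <;> simp

lemma blockPart_realDiag_mul (p : m → Prop) (q : n → Prop) (X : Matrix m n ℂ) (x : m → ℝ) :
    realDiag x * blockPart p q X = blockPart p q (realDiag x * X) := by
  ext i j
  simp only [realDiag_mul_apply, blockPart_apply]
  split_ifs <;> simp

lemma blockPart_mul_realDiag (p : m → Prop) (q : n → Prop) (X : Matrix m n ℂ) (y : n → ℝ) :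
    blockPart p q X * realDiag y = blockPart p q (X * realDiag y) := by
  ext i j
  simp only [mul_realDiag_apply, blockPart_apply]
  split_ifs <;> simp

lemma eq_add_blockPart (p : m → Prop) (q : n → Prop) (X : Matrix m n ℂ) :
    X = blockPart p q X + blockPart (fun i => ¬ p i) (fun j => ¬ q j) X
      + blockPart p (fun j => ¬ q j) X + blockPart (fun i => ¬ p i) q X := by
  ext i j
  simp only [Matrix.add_apply, blockPart_apply]
  by_cases hp : p i <;> by_cases hq : q j <;> simp [hp, hq]

/-- The norm of a block diagonal matrix is at most the maximum of the norms of its blocks. -/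
lemma norm_blockPart_add_compl_le {p : m → Prop} {q : n → Prop} {X : Matrix m n ℂ} {K : ℝ}
    (h1 : ‖blockPart p q X‖ ≤ K)
    (h2 : ‖blockPart (fun i => ¬ p i) (fun j => ¬ q j) X‖ ≤ K) :
    ‖blockPart p q X + blockPart (fun i => ¬ p i) (fun j => ¬ q j) X‖ ≤ K := by
  classical
  have hK : 0 ≤ K := (norm_nonneg _).trans h1
  rw [Matrix.l2_opNorm_def]
  refine ContinuousLinearMap.opNorm_le_bound _ hK fun v => ?_
  set v₁ : EuclideanSpace ℂ n := WithLp.toLp 2 fun j => if q j then v j else 0 with hv₁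
  set v₂ : EuclideanSpace ℂ n := WithLp.toLp 2 fun j => if q j then 0 else v j with hv₂
  have b1 := (Matrix.l2_opNorm_mulVec (blockPart p q X) v₁).trans
    (mul_le_mul_of_nonneg_right h1 (norm_nonneg _))
  have b2 := (Matrix.l2_opNorm_mulVec (blockPart (fun i => ¬ p i) (fun j => ¬ q j) X) v₂).trans
    (mul_le_mul_of_nonneg_right h2 (norm_nonneg _))
  refine abs_le_of_sq_le_sq' ?_ (by positivity) |>.2
  have hv : ‖v‖ ^ 2 = ‖v₁‖ ^ 2 + ‖v₂‖ ^ 2 := by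
    simp only [EuclideanSpace.norm_sq_eq, ← Finset.sum_add_distrib]
    refine Finset.sum_congr rfl fun j _ => ?_
    by_cases hq : q j <;> simp [hv₁, hv₂, hq]
  rw [mul_pow, hv, mul_add, ← mul_pow, ← mul_pow]
  refine le_trans (le_of_eq ?_) (add_le_add (pow_le_pow_left₀ (norm_nonneg _) b1 2)
    (pow_le_pow_left₀ (norm_nonneg _) b2 2))
  simp only [EuclideanSpace.norm_sq_eq, ← Finset.sum_add_distrib]
  refine Finset.sum_congr rfl fun i _ => ?_
  by_cases hp : p i <;>
    simp [Matrix.mulVec, dotProduct, blockPart_apply, hp, hv₁, hv₂]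
  all_goals
    congr 3
    ext j
    by_cases hq : q j <;> simp [hq]

lemma norm_realDiag_mul_le_of_le_of_le {x : m → ℝ} {y : n → ℝ} {X : Matrix m n ℂ} {R : ℝ}
    (hR : 0 ≤ R) (h : ∀ i j, X i j ≠ 0 → (0 ≤ x i ∧ x i ≤ R) ∧ R ≤ y j) :
    ‖realDiag x * X‖ ≤ ‖realDiag x * X + X * realDiag y‖ := by
  refine (norm_realDiag_mul_le hR fun i j hX => ?_).trans
    (le_trans (by simp) (mul_norm_le_norm_sylvester (α := 0) (β := R)
      fun i j hX => ⟨(h i j hX).1.1, (h i j hX).2⟩))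
  rw [abs_of_nonneg (h i j hX).1.1]
  exact (h i j hX).1.2

lemma norm_realDiag_mul_le_of_ge_of_le {x : m → ℝ} {y : n → ℝ} {X : Matrix m n ℂ} {R : ℝ}
    (hR : 0 ≤ R) (h : ∀ i j, X i j ≠ 0 → R ≤ x i ∧ 0 ≤ y j ∧ y j ≤ R) :
    ‖realDiag x * X‖ ≤ 2 * ‖realDiag x * X + X * realDiag y‖ := by
  have h1 : ‖X * realDiag y‖ ≤ ‖realDiag x * X + X * realDiag y‖ := by
    refine (norm_mul_realDiag_le hR fun i j hX => ?_).trans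
      (le_trans (by simp) (mul_norm_le_norm_sylvester (α := R) (β := 0)
        fun i j hX => ⟨(h i j hX).1, (h i j hX).2.1⟩))
    rw [abs_of_nonneg (h i j hX).2.1]
    exact (h i j hX).2.2
  have h2 := norm_sub_le (realDiag x * X + X * realDiag y) (X * realDiag y)
  rw [add_sub_cancel_right] at h2
  linarith

/-- The Schur multiplier `x / (x + y)` has norm growing at most linearly in `k` when both
variables range over an interval `[r, 2 ^ 2 ^ k * r]`. -/
lemma norm_realDiag_mul_le_doubling (k : ℕ) : ∀ {x : m → ℝ} {y : n → ℝ} {X : Matrix m n ℂ} {r : ℝ},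
    0 < r → (∀ i j, X i j ≠ 0 → (r ≤ x i ∧ x i ≤ 2 ^ 2 ^ k * r) ∧
      (r ≤ y j ∧ y j ≤ 2 ^ 2 ^ k * r)) →
    ‖realDiag x * X‖ ≤ (3 * k + 1) * ‖realDiag x * X + X * realDiag y‖ := by
  induction k with
  | zero =>
    intro x y X r hr h
    refine (norm_realDiag_mul_le (K := 2 * r) (by positivity) fun i j hX => ?_).trans
      (le_trans (by linarith) (le_trans (mul_norm_le_norm_sylvester (α := r) (β := r)
        fun i j hX => ⟨(h i j hX).1.1, (h i j hX).2.1⟩) (by simp)))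
    obtain ⟨⟨h1, h2⟩, -⟩ := h i j hX
    rw [abs_of_nonneg (by linarith)]
    simpa using h2
  | succ k ih =>
    intro x y X r hr h
    set R := 2 ^ 2 ^ k * r with hRdef
    have hR : 0 < R := by positivity
    have hRR : (2 : ℝ) ^ 2 ^ (k + 1) * r = 2 ^ 2 ^ k * R := by
      rw [hRdef, pow_succ 2 k, mul_comm (2 ^ k) 2, two_mul, pow_add, mul_assoc]
    rw [hRR] at h
    set Y := realDiag x * X + X * realDiag y with hY
    set p : m → Prop := fun i => x i ≤ R
    set q : n → Prop := fun j => y j ≤ R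
    have c0 : (0 : ℝ) ≤ 3 * k + 1 := by positivity
    have key (p' : m → Prop) (q' : n → Prop) : ‖realDiag x * blockPart p' q' X
        + blockPart p' q' X * realDiag y‖ ≤ ‖Y‖ := by
      rw [blockPart_sylvester]
      exact norm_blockPart_le _ _ _
    have e := eq_add_blockPart p q (realDiag x * X)
    have h1 : ‖blockPart p q (realDiag x * X)‖ ≤ (3 * k + 1) * ‖Y‖ := by
      rw [← blockPart_realDiag_mul]
      refine (ih hr fun i j hX => ?_).trans (mul_le_mul_of_nonneg_left (key _ _) c0)
      obtain ⟨hp, hq, hX⟩ := of_blockPart_ne_zero hX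
      exact ⟨⟨(h i j hX).1.1, hp⟩, (h i j hX).2.1, hq⟩
    have h2 : ‖blockPart (fun i => ¬ p i) (fun j => ¬ q j) (realDiag x * X)‖
        ≤ (3 * k + 1) * ‖Y‖ := by
      rw [← blockPart_realDiag_mul]
      refine (ih hR fun i j hX => ?_).trans (mul_le_mul_of_nonneg_left (key _ _) c0)
      obtain ⟨hp, hq, hX⟩ := of_blockPart_ne_zero hX
      exact ⟨⟨(not_le.1 hp).le, (h i j hX).1.2⟩, (not_le.1 hq).le, (h i j hX).2.2⟩
    have h3 : ‖blockPart p (fun j => ¬ q j) (realDiag x * X)‖ ≤ ‖Y‖ := by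
      rw [← blockPart_realDiag_mul]
      refine (norm_realDiag_mul_le_of_le_of_le hR.le fun i j hX => ?_).trans (key _ _)
      obtain ⟨hp, hq, hX⟩ := of_blockPart_ne_zero hX
      exact ⟨⟨hr.le.trans (h i j hX).1.1, hp⟩, (not_le.1 hq).le⟩
    have h4 : ‖blockPart (fun i => ¬ p i) q (realDiag x * X)‖ ≤ 2 * ‖Y‖ := by
      rw [← blockPart_realDiag_mul]
      refine (norm_realDiag_mul_le_of_ge_of_le hR.le fun i j hX => ?_).trans
        (mul_le_mul_of_nonneg_left (key _ _) zero_le_two)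
      obtain ⟨hp, hq, hX⟩ := of_blockPart_ne_zero hX
      exact ⟨(not_le.1 hp).le, hr.le.trans (h i j hX).2.1, hq⟩
    rw [e]
    refine norm_add₃_le.trans ?_
    have h5 := norm_blockPart_add_compl_le h1 h2
    push_cast
    linarith

lemma norm_realDiag_mul_le_of_sylvester_le {x : m → ℝ} {y : n → ℝ} {X : Matrix m n ℂ}
    {s δ : ℝ} {k : ℕ} (hδ : 0 < δ) (hs : δ ≤ s) (hk : s ≤ 2 ^ 2 ^ k * δ)
    (h : ∀ i j, X i j ≠ 0 → (0 ≤ x i ∧ x i ≤ s) ∧ 0 ≤ y j)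
    (hX : ‖X‖ ≤ 1) (hY : ‖realDiag x * X + X * realDiag y‖ ≤ δ) :
    ‖realDiag x * X‖ ≤ (3 * k + 5) * δ := by
  have key (p : m → Prop) (q : n → Prop) : ‖realDiag x * blockPart p q X
      + blockPart p q X * realDiag y‖ ≤ δ := by
    rw [blockPart_sylvester]
    exact (norm_blockPart_le _ _ _).trans hY
  have keyX (p : m → Prop) (q : n → Prop) : ‖blockPart p q X‖ ≤ 1 :=
    (norm_blockPart_le _ _ _).trans hX
  set Z₁ := blockPart (fun i => x i ≤ δ) (fun _ => True) X with hZ₁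
  set Z₂ := blockPart (fun i => δ < x i) (fun j => y j ≤ δ) X with hZ₂
  set Z₃ := blockPart (fun i => δ < x i) (fun j => δ < y j ∧ y j ≤ s) X with hZ₃
  set Z₄ := blockPart (fun i => δ < x i) (fun j => s < y j) X with hZ₄
  have e : X = Z₁ + Z₂ + Z₃ + Z₄ := by
    ext i j
    simp only [Matrix.add_apply, hZ₁, hZ₂, hZ₃, hZ₄, blockPart_apply]
    by_cases h1 : x i ≤ δ
    · simp [h1, not_lt.2 h1]
    by_cases h2 : y j ≤ δ
    · simp [h1, not_le.1 h1, h2, not_lt.2 h2, h2.trans hs]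
    by_cases h3 : y j ≤ s
    · simp [h1, not_le.1 h1, h2, not_le.1 h2, h3]
    · simp [h1, not_le.1 h1, h2, h3, not_le.1 h3]
  have b1 : ‖realDiag x * Z₁‖ ≤ δ := by
    refine (norm_realDiag_mul_le hδ.le fun i j hZ => ?_).trans
      (mul_le_of_le_one_right hδ.le (keyX _ _))
    obtain ⟨hp, -, hZ⟩ := of_blockPart_ne_zero hZ
    rwa [abs_of_nonneg (h i j hZ).1.1]
  have b2 : ‖realDiag x * Z₂‖ ≤ 2 * δ := by
    have h1 : ‖Z₂ * realDiag y‖ ≤ δ := by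
      refine (norm_mul_realDiag_le hδ.le fun i j hZ => ?_).trans
        (mul_le_of_le_one_right hδ.le (keyX _ _))
      obtain ⟨-, hq, hZ⟩ := of_blockPart_ne_zero hZ
      rwa [abs_of_nonneg (h i j hZ).2]
    have h2 := norm_sub_le (realDiag x * Z₂ + Z₂ * realDiag y) (Z₂ * realDiag y)
    rw [add_sub_cancel_right] at h2
    have h3 : ‖realDiag x * Z₂ + Z₂ * realDiag y‖ ≤ δ := key _ _
    linarith
  have b3 : ‖realDiag x * Z₃‖ ≤ (3 * k + 1) * δ := by
    refine (norm_realDiag_mul_le_doubling k hδ fun i j hZ => ?_).trans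
      (mul_le_mul_of_nonneg_left (key _ _) (by positivity))
    obtain ⟨hp, hq, hZ⟩ := of_blockPart_ne_zero hZ
    exact ⟨⟨hp.le, (h i j hZ).1.2.trans hk⟩, hq.1.le, hq.2.trans hk⟩
  have b4 : ‖realDiag x * Z₄‖ ≤ δ := by
    refine (norm_realDiag_mul_le_of_le_of_le (hδ.le.trans hs) fun i j hZ => ?_).trans (key _ _)
    obtain ⟨hp, hq, hZ⟩ := of_blockPart_ne_zero hZ
    exact ⟨(h i j hZ).1, hq.le⟩
  rw [e, Matrix.mul_add, Matrix.mul_add, Matrix.mul_add]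
  have t1 := norm_add_le (realDiag x * Z₁ + realDiag x * Z₂ + realDiag x * Z₃) (realDiag x * Z₄)
  have t2 := norm_add₃_le (a := realDiag x * Z₁) (b := realDiag x * Z₂) (c := realDiag x * Z₃)
  linarith

lemma norm_mul_realDiag_le_of_sylvester_le {x : m → ℝ} {y : n → ℝ} {X : Matrix m n ℂ}
    {s δ : ℝ} {k : ℕ} (hδ : 0 < δ) (hs : δ ≤ s) (hk : s ≤ 2 ^ 2 ^ k * δ)
    (h : ∀ i j, X i j ≠ 0 → 0 ≤ x i ∧ 0 ≤ y j ∧ y j ≤ s)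
    (hX : ‖X‖ ≤ 1) (hY : ‖realDiag x * X + X * realDiag y‖ ≤ δ) :
    ‖X * realDiag y‖ ≤ (3 * k + 5) * δ := by
  rw [← Matrix.l2_opNorm_conjTranspose, Matrix.conjTranspose_mul, conjTranspose_realDiag]
  refine norm_realDiag_mul_le_of_sylvester_le (y := x) hδ hs hk (fun j i hZ => ?_)
    (by rwa [Matrix.l2_opNorm_conjTranspose]) ?_
  · have := h i j (by simpa using hZ)
    exact ⟨this.2, this.1⟩
  · rw [← Matrix.l2_opNorm_conjTranspose] at hY
    rwa [Matrix.conjTranspose_add, Matrix.conjTranspose_mul, Matrix.conjTranspose_mul,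
      conjTranspose_realDiag, conjTranspose_realDiag, add_comm] at hY

lemma phi_of_nonpos {s t : ℝ} (hs : 0 ≤ s) (ht : t ≤ 0) : phi s t = 0 := by
  rw [phi, abs_of_nonpos ht, abs_of_nonneg hs, abs_of_nonpos (by linarith)]
  ring

lemma phi_of_mem {s t : ℝ} (ht : 0 ≤ t) (hts : t ≤ s) : phi s t = t := by
  rw [phi, abs_of_nonneg ht, abs_of_nonneg (ht.trans hts), abs_of_nonpos (by linarith)]
  ring

lemma phi_of_ge {s t : ℝ} (hs : 0 ≤ s) (hst : s ≤ t) : phi s t = s := by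
  rw [phi, abs_of_nonneg (hs.trans hst), abs_of_nonneg hs, abs_of_nonneg (by linarith)]
  ring

lemma phi_neg_neg (s t : ℝ) : phi (-s) (-t) = phi s t := by
  rw [phi, phi, abs_neg, abs_neg, ← abs_neg (t - s)]
  ring_nf

lemma abs_phi_le_left (s t : ℝ) : |phi s t| ≤ |s| := by
  have h1 := abs_sub_abs_le_abs_sub t s
  have h3 : |t - s| ≤ |t| + |s| := abs_sub t s
  rw [phi, abs_of_nonneg (by linarith)]
  linarith

lemma abs_phi_sub_phi_le (s t u : ℝ) : |phi s t - phi s u| ≤ |t - u| := by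
  have h1 := abs_abs_sub_abs_le_abs_sub t u
  have h2 := abs_abs_sub_abs_le_abs_sub (t - s) (u - s)
  rw [sub_sub_sub_cancel_right] at h2
  rw [abs_le] at h1 h2 ⊢
  rw [phi, phi]
  constructor <;> linarith [h1.1, h1.2, h2.1, h2.2]

lemma norm_phi_commutator_le_of_le {a : m → ℝ} {b : n → ℝ} {U : Matrix m n ℂ} {s δ : ℝ} {k : ℕ}
    (hδ : 0 < δ) (hs : δ ≤ s) (hk : s ≤ 2 ^ 2 ^ k * δ) (hU : ‖U‖ ≤ 1)
    (hD : ‖realDiag a * U - U * realDiag b‖ ≤ δ) :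
    ‖realDiag (fun i => phi s (a i)) * U - U * realDiag (fun j => phi s (b j))‖
      ≤ (12 * k + 23) * δ := by
  have hs0 : 0 < s := hδ.trans_le hs
  set D := realDiag a * U - U * realDiag b with hDdef
  set E := realDiag (fun i => phi s (a i)) * U - U * realDiag (fun j => phi s (b j)) with hE
  have keyU (p : m → Prop) (q : n → Prop) : ‖blockPart p q U‖ ≤ 1 :=
    (norm_blockPart_le _ _ _).trans hU
  have keyD (p : m → Prop) (q : n → Prop) : ‖blockPart p q D‖ ≤ δ :=
    (norm_blockPart_le _ _ _).trans hD
  have appE (i : m) (j : n) : E i j = (phi s (a i) - phi s (b j)) * U i j := by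
    simp only [hE, Matrix.sub_apply, realDiag_mul_apply, mul_realDiag_apply]
    ring
  have appD (i : m) (j : n) : D i j = (a i - b j) * U i j := by
    simp only [hDdef, Matrix.sub_apply, realDiag_mul_apply, mul_realDiag_apply]
    ring
  have congrBlock {p : m → Prop} {q : n → Prop} {X Y : Matrix m n ℂ}
      (h : ∀ i j, p i → q j → X i j = Y i j) : blockPart p q X = blockPart p q Y := by
    ext i j
    simp only [blockPart_apply]
    split_ifs with hpq
    · exact h i j hpq.1 hpq.2
    · rfl
  have pos_sylv {p : m → Prop} {q : n → Prop} {x : m → ℝ} {y : n → ℝ}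
      (h : ∀ i j, x i + y j = a i - b j) :
      ‖realDiag x * blockPart p q U + blockPart p q U * realDiag y‖ ≤ δ := by
    rw [blockPart_sylvester]
    refine le_of_eq_of_le (congrArg _ (congrBlock fun i j _ _ => ?_)) (keyD p q)
    rw [appD, Matrix.add_apply, realDiag_mul_apply, mul_realDiag_apply, ← Complex.ofReal_sub,
      ← h]
    push_cast
    ring
  have neg_sylv {p : m → Prop} {q : n → Prop} {x : m → ℝ} {y : n → ℝ}
      (h : ∀ i j, x i + y j = b j - a i) :
      ‖realDiag x * blockPart p q U + blockPart p q U * realDiag y‖ ≤ δ := by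
    rw [← norm_neg]
    refine le_of_eq_of_le (congrArg _ ?_) (pos_sylv (p := p) (q := q) (x := fun i => - x i)
      (y := fun j => - y j) fun i j => by linarith [h i j])
    ext i j
    simp only [Matrix.neg_apply, Matrix.add_apply, realDiag_mul_apply, mul_realDiag_apply]
    push_cast
    ring
  set pN : m → Prop := fun i => a i ≤ 0
  set pM : m → Prop := fun i => 0 < a i ∧ a i ≤ s
  set pP : m → Prop := fun i => s < a i
  set qN : n → Prop := fun j => b j ≤ 0
  set qM : n → Prop := fun j => 0 < b j ∧ b j ≤ s
  set qP : n → Prop := fun j => s < b j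
  have hNN : blockPart pN qN E = 0 := by
    ext i j
    rw [blockPart_apply]
    split_ifs with h
    · rw [appE, phi_of_nonpos hs0.le h.1, phi_of_nonpos hs0.le h.2]
      simp
    · rfl
  have hPP : blockPart pP qP E = 0 := by
    ext i j
    rw [blockPart_apply]
    split_ifs with h
    · rw [appE, phi_of_ge hs0.le h.1.le, phi_of_ge hs0.le h.2.le]
      simp
    · rfl
  have hMM : ‖blockPart pM qM E‖ ≤ δ := by
    refine le_of_eq_of_le (congrArg _ (congrBlock fun i j hp hq => ?_)) (keyD pM qM)
    rw [appE, appD, phi_of_mem hp.1.le hp.2, phi_of_mem hq.1.le hq.2]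
  have hMN : ‖blockPart pM qN E‖ ≤ (3 * k + 5) * δ := by
    rw [congrBlock (Y := realDiag a * U), ← blockPart_realDiag_mul]
    · refine norm_realDiag_mul_le_of_sylvester_le (y := fun j => - b j) hδ hs hk ?_ (keyU _ _)
        (pos_sylv fun i j => by ring)
      intro i j h
      obtain ⟨hp, hq, -⟩ := of_blockPart_ne_zero h
      exact ⟨⟨hp.1.le, hp.2⟩, neg_nonneg.2 hq⟩
    · intro i j hp hq
      rw [appE, phi_of_mem hp.1.le hp.2, phi_of_nonpos hs0.le hq, realDiag_mul_apply]
      simp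
  have hNM : ‖blockPart pN qM E‖ ≤ (3 * k + 5) * δ := by
    rw [congrBlock (Y := -(U * realDiag b)), ← norm_neg]
    · have e : -blockPart pN qM (-(U * realDiag b)) = blockPart pN qM U * realDiag b := by
        rw [blockPart_mul_realDiag]
        ext i j
        simp only [Matrix.neg_apply, blockPart_apply]
        split_ifs <;> simp
      rw [e]
      refine norm_mul_realDiag_le_of_sylvester_le (x := fun i => - a i) hδ hs hk ?_ (keyU _ _)
        (neg_sylv fun i j => by ring)
      intro i j h
      obtain ⟨hp, hq, -⟩ := of_blockPart_ne_zero h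
      exact ⟨neg_nonneg.2 hp, hq.1.le, hq.2⟩
    · intro i j hp hq
      rw [appE, phi_of_mem hq.1.le hq.2, phi_of_nonpos hs0.le hp, Matrix.neg_apply,
        mul_realDiag_apply]
      push_cast
      ring
  have hPM : ‖blockPart pP qM E‖ ≤ (3 * k + 5) * δ := by
    rw [congrBlock (Y := U * realDiag fun j => s - b j), ← blockPart_mul_realDiag]
    · refine norm_mul_realDiag_le_of_sylvester_le (x := fun i => a i - s) hδ hs hk ?_ (keyU _ _)
        (pos_sylv fun i j => by ring)
      intro i j h
      obtain ⟨hp, hq, -⟩ := of_blockPart_ne_zero h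
      exact ⟨sub_nonneg.2 hp.le, sub_nonneg.2 hq.2, by linarith [hq.1]⟩
    · intro i j hp hq
      rw [appE, phi_of_ge hs0.le hp.le, phi_of_mem hq.1.le hq.2, mul_realDiag_apply]
      push_cast
      ring
  have hMP : ‖blockPart pM qP E‖ ≤ (3 * k + 5) * δ := by
    rw [congrBlock (Y := -(realDiag (fun i => s - a i) * U)), ← norm_neg]
    · have e : -blockPart pM qP (-(realDiag (fun i => s - a i) * U)) =
          realDiag (fun i => s - a i) * blockPart pM qP U := by
        rw [blockPart_realDiag_mul]
        ext i j
        simp only [Matrix.neg_apply, blockPart_apply]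
        split_ifs <;> simp
      rw [e]
      refine norm_realDiag_mul_le_of_sylvester_le (y := fun j => b j - s) hδ hs hk ?_ (keyU _ _)
        (neg_sylv fun i j => by ring)
      intro i j h
      obtain ⟨hp, hq, -⟩ := of_blockPart_ne_zero h
      exact ⟨⟨sub_nonneg.2 hp.2, by linarith [hp.1]⟩, sub_nonneg.2 hq.le⟩
    · intro i j hp hq
      rw [appE, phi_of_ge hs0.le hq.le, phi_of_mem hp.1.le hp.2, Matrix.neg_apply,
        realDiag_mul_apply]
      push_cast
      ring
  have norm_const {p : m → Prop} {q : n → Prop} (c : ℝ)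
      (h : ∀ i j, p i → q j → phi s (a i) - phi s (b j) = c) :
      ‖blockPart p q E‖ = |c| * ‖blockPart p q U‖ := by
    have e : blockPart p q E = (c : ℂ) • blockPart p q U := by
      ext i j
      rw [Matrix.smul_apply, blockPart_apply, blockPart_apply]
      split_ifs with hpq
      · rw [appE, ← h i j hpq.1 hpq.2]
        push_cast
        rfl
      · simp
    rw [e, norm_smul, Complex.norm_real, Real.norm_eq_abs]
  have hPN : ‖blockPart pP qN E‖ ≤ δ := by
    rw [norm_const s, abs_of_pos hs0]
    · refine le_trans (by simp) ((mul_norm_le_norm_sylvester (X := blockPart pP qN U)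
        (x := a) (y := fun j => - b j) (α := s) (β := 0) fun i j h => ?_).trans (pos_sylv fun i j => by ring))
      obtain ⟨hp, hq, -⟩ := of_blockPart_ne_zero h
      exact ⟨hp.le, neg_nonneg.2 hq⟩
    · intro i j hp hq
      rw [phi_of_ge hs0.le hp.le, phi_of_nonpos hs0.le hq, sub_zero]
  have hNP : ‖blockPart pN qP E‖ ≤ δ := by
    rw [norm_const (-s), abs_neg, abs_of_pos hs0]
    · refine le_trans (by simp) ((mul_norm_le_norm_sylvester (X := blockPart pN qP U)
        (x := fun i => - a i) (y := b) (α := 0) (β := s) fun i j h => ?_).trans (neg_sylv fun i j => by ring))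
      obtain ⟨hp, hq, -⟩ := of_blockPart_ne_zero h
      exact ⟨neg_nonneg.2 hp, hq.le⟩
    · intro i j hp hq
      rw [phi_of_ge hs0.le hq.le, phi_of_nonpos hs0.le hp, zero_sub]
  have e : E = (blockPart pN qN E + blockPart pN qM E + blockPart pN qP E)
      + (blockPart pM qN E + blockPart pM qM E + blockPart pM qP E)
      + (blockPart pP qN E + blockPart pP qM E + blockPart pP qP E) := by
    have hcol (p : m → Prop) : blockPart p (fun _ => True) E =
        blockPart p qN E + blockPart p qM E + blockPart p qP E := by
      ext i j
      simp only [Matrix.add_apply, blockPart_apply]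
      by_cases hp : p i
      swap
      · simp [hp]
      by_cases h1 : b j ≤ 0
      · simp [hp, qN, qM, qP, h1, not_lt.2 h1, not_lt.2 (h1.trans hs0.le)]
      by_cases h2 : b j ≤ s
      · simp [hp, qN, qM, qP, h1, not_le.1 h1, h2, not_lt.2 h2]
      · simp [hp, qN, qM, qP, h1, not_le.1 h1, h2, not_le.1 h2]
    rw [← hcol, ← hcol, ← hcol]
    ext i j
    simp only [Matrix.add_apply, blockPart_apply]
    by_cases h1 : a i ≤ 0
    · simp [pN, pM, pP, h1, not_lt.2 h1, not_lt.2 (h1.trans hs0.le)]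
    by_cases h2 : a i ≤ s
    · simp [pN, pM, pP, h1, not_le.1 h1, h2, not_lt.2 h2]
    · simp [pN, pM, pP, h1, not_le.1 h1, h2, not_le.1 h2]
  rw [e, hNN, hPP, zero_add, add_zero]
  refine norm_add₃_le.trans ?_
  have t1 := norm_add_le (blockPart pN qM E) (blockPart pN qP E)
  have t2 := norm_add₃_le (a := blockPart pM qN E) (b := blockPart pM qM E)
    (c := blockPart pM qP E)
  have t3 := norm_add_le (blockPart pP qN E) (blockPart pP qM E)
  linarith

lemma norm_phi_commutator_le_two_mul (a : m → ℝ) (b : n → ℝ) {U : Matrix m n ℂ} (s : ℝ)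
    (hU : ‖U‖ ≤ 1) :
    ‖realDiag (fun i => phi s (a i)) * U - U * realDiag (fun j => phi s (b j))‖ ≤ 2 * |s| := by
  have h1 : ‖realDiag (fun i => phi s (a i)) * U‖ ≤ |s| * ‖U‖ :=
    norm_realDiag_mul_le (abs_nonneg s) fun _ _ _ => abs_phi_le_left _ _
  have h2 : ‖U * realDiag (fun j => phi s (b j))‖ ≤ |s| * ‖U‖ :=
    norm_mul_realDiag_le (abs_nonneg s) fun _ _ _ => abs_phi_le_left _ _
  have h3 := mul_le_mul_of_nonneg_left hU (abs_nonneg s)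
  linarith [norm_sub_le (realDiag (fun i => phi s (a i)) * U)
    (U * realDiag (fun j => phi s (b j)))]

lemma exists_two_pow_two_pow_ge {L : ℝ} (hL : 1 ≤ L) :
    ∃ k : ℕ, L ≤ 2 ^ 2 ^ k ∧ (12 * k + 23 : ℝ) ≤ 200 * Real.log (1 + Real.log (1 + L)) := by
  have hlog2 := Real.log_two_gt_d9
  have hx : Real.log 2 ≤ Real.log (1 + L) := Real.log_le_log two_pos (by linarith)
  set x := Real.log (1 + L) with hxdef
  have hT : 1 / 3 ≤ Real.log (1 + x) := by
    have h := Real.one_sub_inv_le_log_of_pos (x := 1 + x) (by linarith)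
    have : (1 + x)⁻¹ ≤ 2 / 3 := by
      rw [inv_le_comm₀ (by linarith) (by norm_num)]
      linarith
    linarith
  have hex : ∃ k : ℕ, L ≤ 2 ^ 2 ^ k := by
    obtain ⟨N, hN⟩ := pow_unbounded_of_one_lt L (one_lt_two (α := ℝ))
    exact ⟨N, hN.le.trans (pow_le_pow_right₀ one_le_two Nat.lt_two_pow_self.le)⟩
  classical
  refine ⟨Nat.find hex, Nat.find_spec hex, ?_⟩
  have hmin := fun {l : ℕ} => Nat.find_min (m := l) hex
  generalize Nat.find hex = k at hmin
  rcases k with _ | k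
  · norm_num
    linarith
  · have h1 : (2 : ℝ) ^ 2 ^ k < L := not_le.1 (hmin (Nat.lt_succ_self k))
    have h2 : (2 : ℝ) ^ k * Real.log 2 ≤ x := by
      have := Real.log_le_log (by positivity) (h1.le.trans (by linarith : L ≤ 1 + L))
      rw [Real.log_pow] at this
      exact_mod_cast this
    have h3 : (2 : ℝ) ^ k ≤ 2 * (1 + x) := by nlinarith [pow_pos (two_pos (α := ℝ)) k]
    have h4 := Real.log_le_log (by positivity) h3
    rw [Real.log_pow, Real.log_mul two_ne_zero (by linarith)] at h4
    have h5 : (k : ℝ) ≤ 1 + 3 / 2 * Real.log (1 + x) := by nlinarith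
    push_cast
    linarith

lemma le_log_one_add_log_one_add {L : ℝ} (hL : 0 ≤ L) (hL1 : L ≤ 1) :
    L ≤ 4 * Real.log (1 + Real.log (1 + L)) := by
  have key {z : ℝ} (hz : 0 ≤ z) (hz1 : z ≤ 1) : z ≤ 2 * Real.log (1 + z) := by
    have h := Real.one_sub_inv_le_log_of_pos (x := 1 + z) (by linarith)
    have : z / 2 ≤ 1 - (1 + z)⁻¹ := by
      have h0 : 1 + z ≠ 0 := by linarith
      rw [show 1 - (1 + z)⁻¹ = z / (1 + z) by field_simp; ring]
      exact div_le_div_of_nonneg_left hz (by linarith) (by linarith)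
    linarith
  have h1 := key hL hL1
  have h2 : Real.log (1 + L) ≤ 1 := by
    have := Real.log_le_sub_one_of_pos (x := 1 + L) (by linarith)
    linarith
  have h3 := key (by linarith) h2
  linarith

/-- The commutator estimate for the functions `phi s`. -/
lemma norm_phi_commutator_le {a : m → ℝ} {b : n → ℝ} {U : Matrix m n ℂ} (s : ℝ) {δ : ℝ}
    (hδ : 0 < δ) (hU : ‖U‖ ≤ 1) (hD : ‖realDiag a * U - U * realDiag b‖ ≤ δ) :
    ‖realDiag (fun i => phi s (a i)) * U - U * realDiag (fun j => phi s (b j))‖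
      ≤ 200 * δ * Real.log (1 + Real.log (1 + |s| / δ)) := by
  rcases le_total |s| δ with hsδ | hsδ
  · have h1 := norm_phi_commutator_le_two_mul a b s hU
    have h2 := le_log_one_add_log_one_add (L := |s| / δ) (by positivity)
      ((div_le_one hδ).2 hsδ)
    have h3 := mul_le_mul_of_nonneg_left h2 hδ.le
    rw [mul_div_cancel₀ _ hδ.ne'] at h3
    nlinarith [abs_nonneg s]
  · obtain ⟨k, hk, hk'⟩ := exists_two_pow_two_pow_ge ((one_le_div hδ).2 hsδ)
    refine le_trans ?_ ((mul_le_mul_of_nonneg_right hk' hδ.le).trans_eq (by ring))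
    rw [div_le_iff₀ hδ] at hk
    rcases le_total 0 s with hs | hs
    · rw [abs_of_nonneg hs] at hsδ hk
      exact norm_phi_commutator_le_of_le hδ hsδ hk hU hD
    · rw [abs_of_nonpos hs] at hsδ hk
      have hD' : ‖realDiag (fun i => - a i) * U - U * realDiag (fun j => - b j)‖ ≤ δ := by
        rw [← norm_neg]
        refine le_of_eq_of_le (congrArg norm ?_) hD
        ext i j
        simp only [Matrix.neg_apply, Matrix.sub_apply, realDiag_mul_apply, mul_realDiag_apply]
        push_cast
        ring
      simpa only [phi_neg_neg] using norm_phi_commutator_le_of_le hδ hsδ hk hU hD'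

end DiagonalWeights

lemma log_one_add_log_one_add_nonneg {x : ℝ} (hx : 0 ≤ x) :
    0 ≤ Real.log (1 + Real.log (1 + x)) := by
  have := Real.log_nonneg (by linarith : 1 ≤ 1 + x)
  exact Real.log_nonneg (by linarith)

lemma measurable_log_one_add_log_one_add (δ : ℝ) :
    Measurable fun s : ℝ => Real.log (1 + Real.log (1 + |s| / δ)) := by
  have h : Measurable fun s : ℝ => |s| := continuous_abs.measurable
  exact Real.measurable_log.comp
    (measurable_const.add (Real.measurable_log.comp (measurable_const.add (h.div_const δ))))

lemma integrable_log_one_add_log_one_add {ν : Measure ℝ} [IsFiniteMeasure ν]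
    (h : Integrable (fun s => Real.log (1 + Real.log (1 + |s|))) ν) {δ : ℝ} (hδ : 0 < δ) :
    Integrable (fun s => Real.log (1 + Real.log (1 + |s| / δ))) ν := by
  refine (h.add (integrable_const (Real.log (1 + Real.log (1 + 1 / δ))))).mono'
    (measurable_log_one_add_log_one_add δ).aestronglyMeasurable (ae_of_all _ fun s => ?_)
  have hs := abs_nonneg s
  have hd : 0 ≤ 1 / δ := by positivity
  have h0 : 0 ≤ |s| / δ := by positivity
  have l0 := Real.log_nonneg (by linarith : 1 ≤ 1 + |s| / δ)
  have l1 := Real.log_nonneg (by linarith : 1 ≤ 1 + |s|)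
  have l2 := Real.log_nonneg (by linarith : 1 ≤ 1 + 1 / δ)
  have h1 : Real.log (1 + |s| / δ) ≤ Real.log (1 + |s|) + Real.log (1 + 1 / δ) := by
    rw [← Real.log_mul (by linarith) (by linarith)]
    refine Real.log_le_log (by linarith) ?_
    have : |s| / δ = |s| * (1 / δ) := by ring
    nlinarith
  rw [Real.norm_of_nonneg (log_one_add_log_one_add_nonneg h0), Pi.add_apply,
    ← Real.log_mul (by linarith) (by linarith)]
  refine Real.log_le_log (by linarith) ?_
  nlinarith [mul_nonneg l1 l2]

lemma continuous_phi_left (t : ℝ) : Continuous fun s => phi s t := by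
  unfold phi
  fun_prop

lemma abs_phi_le_right (s t : ℝ) : |phi s t| ≤ |t| := by
  have h := abs_phi_sub_phi_le s t 0
  simpa [phi] using h

section Integral

variable {ν : Measure ℝ} [IsFiniteMeasure ν] {w : ℝ → ℂ}

lemma integrable_phi_mul (hw : Measurable w) (hw1 : ∀ s, ‖w s‖ = 1) (t : ℝ) :
    Integrable (fun s => (phi s t : ℂ) * w s) ν := by
  refine (integrable_const |t|).mono'
    ((Complex.measurable_ofReal.comp (continuous_phi_left t).measurable).mul
      hw).aestronglyMeasurable (ae_of_all _ fun s => ?_)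
  rw [norm_mul, hw1, mul_one, Complex.norm_real]
  exact abs_phi_le_right s t

lemma continuous_of_eq_sub_integral_phi (hw : Measurable w) (hw1 : ∀ s, ‖w s‖ = 1) {c₀ : ℂ}
    {f : ℝ → ℂ} (hf : ∀ t : ℝ, f t = c₀ - ∫ s, (phi s t : ℂ) * w s ∂ν) : Continuous f := by
  refine (LipschitzWith.of_dist_le_mul (K := (ν.real Set.univ).toNNReal)
    fun t u => ?_).continuous
  rw [Real.coe_toNNReal _ measureReal_nonneg, dist_eq_norm]
  have e : f t - f u = (∫ s, (phi s u : ℂ) * w s ∂ν) - ∫ s, (phi s t : ℂ) * w s ∂ν := by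
    rw [hf, hf]
    ring
  rw [e, ← integral_sub (integrable_phi_mul hw hw1 u) (integrable_phi_mul hw hw1 t), dist_comm,
    mul_comm]
  refine norm_integral_le_of_norm_le_const (ae_of_all _ fun s => ?_)
  rw [← sub_mul, norm_mul, hw1, mul_one, ← Complex.ofReal_sub, Complex.norm_real]
  exact abs_phi_sub_phi_le s u t

open scoped Matrix.Norms.L2Operator in
lemma norm_commutator_le_of_eq_sub_integral_phi {m n : Type*} [Fintype m] [Fintype n]
    [DecidableEq m] [DecidableEq n] (hw : Measurable w) (hw1 : ∀ s, ‖w s‖ = 1)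
    (h : Integrable (fun s => Real.log (1 + Real.log (1 + |s|))) ν) {c₀ : ℂ}
    {f : ℝ → ℂ} (hf : ∀ t : ℝ, f t = c₀ - ∫ s, (phi s t : ℂ) * w s ∂ν) {δ : ℝ} (hδ : 0 < δ)
    {a : m → ℝ} {b : n → ℝ} {U : Matrix m n ℂ} (hU : ‖U‖ ≤ 1)
    (hD : ‖realDiag a * U - U * realDiag b‖ ≤ δ) :
    ‖Matrix.diagonal (fun i => f (a i)) * U - U * Matrix.diagonal (fun j => f (b j))‖
      ≤ 200 * δ * ∫ s, Real.log (1 + Real.log (1 + |s| / δ)) ∂ν := by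
  have hint (i : m) (j : n) :
      Integrable (fun s => (phi s (b j) : ℂ) * w s - (phi s (a i) : ℂ) * w s) ν :=
    (integrable_phi_mul hw hw1 _).sub (integrable_phi_mul hw hw1 _)
  have e : Matrix.diagonal (fun i => f (a i)) * U - U * Matrix.diagonal (fun j => f (b j)) =
      ∫ s, ∑ i, ∑ j, ((phi s (b j) : ℂ) * w s - (phi s (a i) : ℂ) * w s) •
        Matrix.single i j (U i j) ∂ν := by
    rw [integral_finsetSum _ fun i _ =>
      integrable_finsetSum _ fun j _ => (hint i j).smul_const _]
    simp_rw [integral_finsetSum _ fun j _ => (hint _ j).smul_const _, integral_smul_const]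
    ext i j
    simp only [Matrix.sub_apply, Matrix.diagonal_mul, Matrix.mul_diagonal, Matrix.sum_apply,
      Matrix.smul_apply, Matrix.single_apply]
    simp only [smul_eq_mul, mul_ite, mul_zero, ite_and]
    simp
    rw [integral_sub (integrable_phi_mul hw hw1 _) (integrable_phi_mul hw hw1 _), hf, hf]
    ring
  rw [e, ← integral_const_mul]
  refine norm_integral_le_of_norm_le ((integrable_log_one_add_log_one_add h hδ).const_mul _)
    (ae_of_all _ fun s => ?_)
  refine le_of_eq_of_le ?_ (norm_phi_commutator_le s hδ hU hD)
  have e' : ∑ i, ∑ j, ((phi s (b j) : ℂ) * w s - (phi s (a i) : ℂ) * w s) •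
      Matrix.single i j (U i j) = (-w s) •
        (realDiag (fun i => phi s (a i)) * U - U * realDiag (fun j => phi s (b j))) := by
    ext i j
    simp only [Matrix.sub_apply, Matrix.sum_apply, Matrix.smul_apply, Matrix.single_apply,
      realDiag_mul_apply, mul_realDiag_apply]
    simp only [smul_eq_mul, mul_ite, mul_zero, ite_and]
    simp
    ring
  rw [e', norm_smul, norm_neg, hw1, one_mul]

end Integral

section FiniteDimensional

open scoped Matrix.Norms.L2Operator InnerProductSpace

variable {V : Type*} [NormedAddCommGroup V] [InnerProductSpace ℂ V]

section MixedBases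

set_option linter.unusedSectionVars false

variable {ι : Type*} [Fintype ι] [DecidableEq ι]

/-- The matrix of a linear map with respect to a pair of orthonormal bases. -/
noncomputable def mixedMatrix (e g : OrthonormalBasis ι ℂ V) (T : V →ₗ[ℂ] V) : Matrix ι ι ℂ :=
  Matrix.of fun i j => ⟪e i, T (g j)⟫_ℂ

lemma mixedMatrix_mulVec (e g : OrthonormalBasis ι ℂ V) (T : V →ₗ[ℂ] V) (x : V) :
    WithLp.toLp 2 ((mixedMatrix e g T).mulVec (g.repr x)) = e.repr (T x) := by
  ext i
  conv_rhs => rw [← g.sum_repr x]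
  simp [mixedMatrix, Matrix.mulVec, dotProduct, OrthonormalBasis.repr_apply_apply, mul_comm]

lemma norm_mixedMatrix_le (e g : OrthonormalBasis ι ℂ V) {T : V →ₗ[ℂ] V} {c : ℝ} (hc : 0 ≤ c)
    (hT : ∀ v, ‖T v‖ ≤ c * ‖v‖) : ‖mixedMatrix e g T‖ ≤ c := by
  rw [Matrix.l2_opNorm_def]
  refine ContinuousLinearMap.opNorm_le_bound _ hc fun v => ?_
  have h := mixedMatrix_mulVec e g T (g.repr.symm v)
  rw [LinearIsometryEquiv.apply_symm_apply] at h
  refine le_of_eq_of_le (congrArg norm h) ?_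
  rw [LinearIsometryEquiv.norm_map]
  simpa using hT (g.repr.symm v)

lemma norm_apply_le_mixedMatrix (e g : OrthonormalBasis ι ℂ V) (T : V →ₗ[ℂ] V) (x : V) :
    ‖T x‖ ≤ ‖mixedMatrix e g T‖ * ‖x‖ := by
  have h := Matrix.l2_opNorm_mulVec (mixedMatrix e g T) (g.repr x)
  rw [LinearIsometryEquiv.norm_map] at h
  refine le_of_eq_of_le ?_ h
  rw [← LinearIsometryEquiv.norm_map e.repr, ← mixedMatrix_mulVec]
  rfl

end MixedBases

lemma inner_aeval_apply {A : V →ₗ[ℂ] V} {e : V} {z : ℂ} (h : ∀ v, ⟪e, A v⟫_ℂ = z * ⟪e, v⟫_ℂ)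
    (p : Polynomial ℂ) (v : V) :
    ⟪e, Polynomial.aeval A p v⟫_ℂ = p.eval z * ⟪e, v⟫_ℂ := by
  induction p using Polynomial.induction_on' generalizing v with
  | add p q hp hq => simp [hp, hq, add_mul]
  | monomial k c =>
    have hk (v : V) : ⟪e, (A ^ k) v⟫_ℂ = z ^ k * ⟪e, v⟫_ℂ := by
      induction k generalizing v with
      | zero => simp
      | succ k ih => rw [pow_succ, Module.End.mul_apply, ih, h, pow_succ, mul_assoc]
    rw [Polynomial.aeval_monomial, Polynomial.eval_monomial, Module.End.mul_apply,
      Module.algebraMap_end_apply, inner_smul_right, hk, mul_assoc]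

lemma norm_aeval_sub_aeval_le [FiniteDimensional ℂ V] {A B : V →ₗ[ℂ] V} (hA : A.IsSymmetric)
    (hB : B.IsSymmetric) {δ R K ε : ℝ} (hδ : 0 ≤ δ) (hε : 0 ≤ ε) {f : ℝ → ℂ} {p : Polynomial ℂ}
    (hK : ∀ (N : ℕ) (a b : Fin N → ℝ) (U : Matrix (Fin N) (Fin N) ℂ), ‖U‖ ≤ 1 →
      ‖realDiag a * U - U * realDiag b‖ ≤ δ →
      ‖Matrix.diagonal (fun i => f (a i)) * U - U * Matrix.diagonal (fun j => f (b j))‖ ≤ K)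
    (hAR : ∀ v, ‖A v‖ ≤ R * ‖v‖) (hBR : ∀ v, ‖B v‖ ≤ R * ‖v‖)
    (hAB : ∀ v, ‖A v - B v‖ ≤ δ * ‖v‖)
    (hp : ∀ t : ℝ, |t| ≤ R → ‖p.eval (t : ℂ) - f t‖ ≤ ε) (x : V) :
    ‖Polynomial.aeval A p x - Polynomial.aeval B p x‖ ≤ (K + 2 * ε) * ‖x‖ := by
  set e := hA.eigenvectorBasis rfl with he
  set g := hB.eigenvectorBasis rfl with hg
  set a := hA.eigenvalues rfl with ha
  set b := hB.eigenvalues rfl with hb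
  have hAe (i) : A (e i) = (a i : ℂ) • e i := hA.apply_eigenvectorBasis rfl i
  have hBg (i) : B (g i) = (b i : ℂ) • g i := hB.apply_eigenvectorBasis rfl i
  have hbd {C : V →ₗ[ℂ] V} {v : V} {t : ℝ} (hC : ∀ v, ‖C v‖ ≤ R * ‖v‖) (hv : ‖v‖ = 1)
      (h : C v = (t : ℂ) • v) : |t| ≤ R := by
    have := hC v
    rwa [h, norm_smul, hv, mul_one, mul_one, Complex.norm_real] at this
  have hpa (i) : ‖p.eval (a i : ℂ) - f (a i)‖ ≤ ε :=
    hp _ (hbd hAR (e.orthonormal.1 i) (hAe i))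
  have hpb (j) : ‖p.eval (b j : ℂ) - f (b j)‖ ≤ ε :=
    hp _ (hbd hBR (g.orthonormal.1 j) (hBg j))
  have hinner (i) (v : V) : ⟪e i, A v⟫_ℂ = a i * ⟪e i, v⟫_ℂ := by
    rw [← hA, hAe, inner_smul_left, Complex.conj_ofReal]
  set U := mixedMatrix e g LinearMap.id with hUdef
  have hU : ‖U‖ ≤ 1 := norm_mixedMatrix_le e g zero_le_one (by simp)
  have hD : ‖realDiag a * U - U * realDiag b‖ ≤ δ := by
    refine le_of_eq_of_le (congrArg _ ?_) (norm_mixedMatrix_le e g (T := A - B) hδ (by simpa))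
    ext i j
    simp only [Matrix.sub_apply, realDiag_mul_apply, mul_realDiag_apply, hUdef, mixedMatrix,
      Matrix.of_apply, LinearMap.sub_apply, inner_sub_right, hinner, hBg, inner_smul_right,
      LinearMap.id_apply]
    ring
  have hBp (j) : Polynomial.aeval B p (g j) = p.eval (b j : ℂ) • g j :=
    Module.End.aeval_apply_of_hasEigenvector (hB.hasEigenvector_eigenvectorBasis rfl j)
  have hE : mixedMatrix e g (Polynomial.aeval A p - Polynomial.aeval B p) =
      (Matrix.diagonal (fun i => f (a i)) * U - U * Matrix.diagonal (fun j => f (b j)))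
        + Matrix.diagonal (fun i => p.eval (a i : ℂ) - f (a i)) * U
        + -(U * Matrix.diagonal (fun j => p.eval (b j : ℂ) - f (b j))) := by
    ext i j
    simp only [Matrix.sub_apply, Matrix.add_apply, Matrix.neg_apply, Matrix.diagonal_mul,
      Matrix.mul_diagonal, hUdef, mixedMatrix, Matrix.of_apply, LinearMap.sub_apply,
      inner_sub_right, inner_aeval_apply (hinner i), hBp, inner_smul_right, LinearMap.id_apply]
    ring
  have hdiag {c : Fin (Module.finrank ℂ V) → ℂ} (hc : ∀ i, ‖c i‖ ≤ ε) :
      ‖Matrix.diagonal c‖ ≤ ε := by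
    rw [Matrix.l2_opNorm_diagonal]
    exact (pi_norm_le_iff_of_nonneg hε).2 hc
  have h1 : ‖Matrix.diagonal (fun i => p.eval (a i : ℂ) - f (a i)) * U‖ ≤ ε * 1 :=
    (Matrix.l2_opNorm_mul _ _).trans (mul_le_mul (hdiag hpa) hU (norm_nonneg _) hε)
  have h2 : ‖-(U * Matrix.diagonal (fun j => p.eval (b j : ℂ) - f (b j)))‖ ≤ 1 * ε := by
    rw [norm_neg]
    exact (Matrix.l2_opNorm_mul _ _).trans (mul_le_mul hU (hdiag hpb) (norm_nonneg _) zero_le_one)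
  have h3 : ‖mixedMatrix e g (Polynomial.aeval A p - Polynomial.aeval B p)‖ ≤ K + 2 * ε := by
    rw [hE]
    refine norm_add₃_le.trans ?_
    linarith [hK _ a b U hU hD]
  exact (norm_apply_le_mixedMatrix e g (Polynomial.aeval A p - Polynomial.aeval B p) x).trans
    (mul_le_mul_of_nonneg_right h3 (norm_nonneg _))

end FiniteDimensional

section Compression

variable {H : Type*} [NormedAddCommGroup H] [InnerProductSpace ℂ H]

/-- The compression of an operator to a subspace. -/
noncomputable def compression (V : Submodule ℂ H) [V.HasOrthogonalProjection] (A : H →L[ℂ] H) :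
    V →ₗ[ℂ] V :=
  (V.orthogonalProjectionOnto ∘L A ∘L V.subtypeL : V →L[ℂ] V)

variable (V : Submodule ℂ H) [V.HasOrthogonalProjection]

lemma compression_apply (A : H →L[ℂ] H) (v : V) :
    compression V A v = V.orthogonalProjectionOnto (A v) := rfl

lemma compression_isSymmetric [CompleteSpace H] {A : H →L[ℂ] H} (hA : IsSelfAdjoint A) :
    (compression V A).IsSymmetric := by
  intro v u
  have h := hA.isSymmetric (v : H) (u : H)
  rwa [compression_apply, compression_apply,
    Submodule.inner_orthogonalProjectionOnto_eq_of_mem_right,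
    Submodule.inner_orthogonalProjectionOnto_eq_of_mem_left]

lemma coe_aeval_compression_apply {A : H →L[ℂ] H} {x : V} {p : Polynomial ℂ}
    (h : ∀ k ≤ p.natDegree, (A ^ k) (x : H) ∈ V) :
    (Polynomial.aeval (compression V A) p x : H) = Polynomial.aeval A p (x : H) := by
  have hk (k : ℕ) (hk : k ≤ p.natDegree) : ((compression V A ^ k) x : H) = (A ^ k) (x : H) := by
    induction k with
    | zero => simp
    | succ k ih =>
      rw [pow_succ', Module.End.mul_apply, compression_apply, ih (by omega), pow_succ',
        mul_apply_eq_comp]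
      have hmem : A ((A ^ k) (x : H)) ∈ V := by simpa [pow_succ'] using h _ hk
      exact congrArg Subtype.val (V.orthogonalProjectionOnto_mem_subspace_eq_self ⟨_, hmem⟩)
  rw [Polynomial.aeval_eq_sum_range, Polynomial.aeval_eq_sum_range]
  simp only [LinearMap.sum_apply, LinearMap.smul_apply, sum_apply, smul_apply,
    Submodule.coe_sum, Submodule.coe_smul]
  refine Finset.sum_congr rfl fun k hk' => ?_
  rw [hk k (by simpa [Nat.lt_succ_iff] using hk')]

end Compression

lemma exists_complex_polynomial_near {f : ℝ → ℂ} (hf : Continuous f) (R : ℝ) {ε : ℝ}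
    (hε : 0 < ε) :
    ∃ p : Polynomial ℂ, ∀ t : ℝ, |t| ≤ R → ‖p.eval (t : ℂ) - f t‖ ≤ ε := by
  obtain ⟨p, hp⟩ := exists_polynomial_near_of_continuousOn (-R) R (fun t => (f t).re)
    (Complex.continuous_re.comp hf).continuousOn (ε / 2) (half_pos hε)
  obtain ⟨q, hq⟩ := exists_polynomial_near_of_continuousOn (-R) R (fun t => (f t).im)
    (Complex.continuous_im.comp hf).continuousOn (ε / 2) (half_pos hε)
  refine ⟨p.map (algebraMap ℝ ℂ) + Polynomial.C Complex.I * q.map (algebraMap ℝ ℂ),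
    fun t ht => ?_⟩
  have h1 := hp t (abs_le.1 ht)
  have h2 := hq t (abs_le.1 ht)
  have e (r : Polynomial ℝ) : (r.map (algebraMap ℝ ℂ)).eval (t : ℂ) = (r.eval t : ℝ) :=
    Polynomial.eval_map_algebraMap .. |>.trans (Polynomial.aeval_algebraMap_apply_eq_algebraMap_eval t r)
  rw [Polynomial.eval_add, Polynomial.eval_mul, Polynomial.eval_C, e, e]
  refine (Complex.norm_le_abs_re_add_abs_im _).trans ?_
  simp
  linarith

open scoped Matrix.Norms.L2Operator in
/-- Commutator estimates for matrices imply operator estimates on every Hilbert space. -/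
lemma norm_cfcC_sub_cfcC_le {f : ℝ → ℂ} (hf : Continuous f) {δ K : ℝ} (hδ : 0 ≤ δ)
    (hK : ∀ (N : ℕ) (a b : Fin N → ℝ) (U : Matrix (Fin N) (Fin N) ℂ), ‖U‖ ≤ 1 →
      ‖realDiag a * U - U * realDiag b‖ ≤ δ →
      ‖Matrix.diagonal (fun i => f (a i)) * U - U * Matrix.diagonal (fun j => f (b j))‖ ≤ K)
    {H : Type} [NormedAddCommGroup H] [InnerProductSpace ℂ H] [CompleteSpace H]
    {A B : H →L[ℂ] H} (hA : IsSelfAdjoint A) (hB : IsSelfAdjoint B) (hAB : ‖A - B‖ ≤ δ) :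
    ‖cfcC f A - cfcC f B‖ ≤ K := by
  have hK0 : 0 ≤ K := (norm_nonneg _).trans (hK 0 0 0 0 (by simp) (by simpa using hδ))
  refine le_of_forall_pos_le_add fun ε' hε' => ?_
  obtain ⟨ε, hε, rfl⟩ : ∃ ε, 0 < ε ∧ 4 * ε = ε' := ⟨ε' / 4, by positivity, by ring⟩
  set R := ‖A‖ + ‖B‖ + (‖A‖ + ‖B‖) * ‖(1 : H →L[ℂ] H)‖ with hR
  obtain ⟨p, hp⟩ := exists_complex_polynomial_near hf R hε
  have approx {T : H →L[ℂ] H} (hT : IsSelfAdjoint T) (hTR : ‖T‖ ≤ ‖A‖ + ‖B‖) :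
      ‖cfcC f T - Polynomial.aeval T p‖ ≤ ε := by
    have hcont : Continuous fun z : ℂ => f z.re := hf.comp Complex.continuous_re
    have hn : IsStarNormal T := hT.isStarNormal
    rw [cfcC, ← cfc_polynomial p T hn,
      ← cfc_sub (fun z : ℂ => f z.re) p.eval T hcont.continuousOn p.continuous.continuousOn]
    refine norm_cfc_le hε.le fun z hz => ?_
    rw [hT.mem_spectrum_eq_re hz, norm_sub_rev, Complex.ofReal_re]
    refine hp _ ((Complex.abs_re_le_norm z).trans ((spectrum.norm_le_norm_mul_of_mem hz).trans ?_))
    have := mul_le_mul_of_nonneg_right hTR (norm_nonneg (1 : H →L[ℂ] H))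
    linarith [norm_nonneg A, norm_nonneg B]
  have poly : ‖Polynomial.aeval A p - Polynomial.aeval B p‖ ≤ K + 2 * ε := by
    refine ContinuousLinearMap.opNorm_le_bound _ (by positivity) fun x => ?_
    set S : Set H := (fun k => (A ^ k) x) '' Set.Iic p.natDegree ∪
      (fun k => (B ^ k) x) '' Set.Iic p.natDegree with hS
    have hSfin : S.Finite := ((Set.finite_Iic _).image _).union ((Set.finite_Iic _).image _)
    set V := Submodule.span ℂ S
    have : FiniteDimensional ℂ V := FiniteDimensional.span_of_finite ℂ hSfin
    have hAV (k : ℕ) (hk : k ≤ p.natDegree) : (A ^ k) x ∈ V :=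
      Submodule.subset_span (Or.inl ⟨k, hk, rfl⟩)
    have hBV (k : ℕ) (hk : k ≤ p.natDegree) : (B ^ k) x ∈ V :=
      Submodule.subset_span (Or.inr ⟨k, hk, rfl⟩)
    have hx : x ∈ V := by simpa using hAV 0 (Nat.zero_le _)
    have hproj {T : H →L[ℂ] H} {c : ℝ} (hT : ‖T‖ ≤ c) (v : V) :
        ‖compression V T v‖ ≤ c * ‖v‖ :=
      (V.norm_orthogonalProjectionOnto_apply_le _).trans (T.le_of_opNorm_le hT v)
    have hABR : ‖A‖ + ‖B‖ ≤ R := by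
      rw [hR]
      exact le_add_of_nonneg_right (by positivity)
    have key := norm_aeval_sub_aeval_le (compression_isSymmetric V hA)
      (compression_isSymmetric V hB) hδ hε.le hK
      (hproj ((le_add_of_nonneg_right (norm_nonneg B)).trans hABR))
      (hproj ((le_add_of_nonneg_left (norm_nonneg A)).trans hABR))
      (fun v => by
        have := hproj hAB v
        rwa [compression_apply, sub_apply, map_sub] at this)
      hp ⟨x, hx⟩
    rw [Submodule.coe_norm, Submodule.coe_sub,
      coe_aeval_compression_apply V hAV, coe_aeval_compression_apply V hBV] at key
    exact key
  have h1 := approx hA (le_add_of_nonneg_right (norm_nonneg B))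
  have h2 := approx hB (le_add_of_nonneg_left (norm_nonneg A))
  have e : cfcC f A - cfcC f B = (cfcC f A - Polynomial.aeval A p)
      + (Polynomial.aeval A p - Polynomial.aeval B p)
      + -(cfcC f B - Polynomial.aeval B p) := by abel
  rw [e]
  refine norm_add₃_le.trans ?_
  rw [norm_neg]
  linarith

/-- A finite complex Borel measure μ on ℝ is encoded by its polar decomposition
dμ = w d ν, where ν = |μ| is a finite positive Borel measure and ‖w‖ = 1. -/
theorem stmt6 :
    ∃ C : ℝ, 0 < C ∧
      ∀ ν : Measure ℝ, IsFiniteMeasure ν →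
        ∀ w : ℝ → ℂ, Measurable w → (∀ s, ‖w s‖ = 1) →
        Integrable (fun s => Real.log (1 + Real.log (1 + |s|))) ν →
        ∀ (c₀ : ℂ) (f : ℝ → ℂ),
          (∀ t : ℝ, f t = c₀ - ∫ s, (phi s t : ℂ) * w s ∂ν) →
          ∀ δ : ℝ, 0 < δ →
          ∀ (H : Type) [NormedAddCommGroup H] [InnerProductSpace ℂ H] [CompleteSpace H]
            (A B : H →L[ℂ] H), IsSelfAdjoint A → IsSelfAdjoint B → ‖A - B‖ ≤ δ →
            ‖cfcC f A - cfcC f B‖ ≤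
              C * δ * ∫ s, Real.log (1 + Real.log (1 + |s| / δ)) ∂ν := by
  refine ⟨200, by norm_num, fun ν hν w hw hw1 hint c₀ f hf δ hδ H _ _ _ A B hA hB hAB => ?_⟩
  exact norm_cfcC_sub_cfcC_le (continuous_of_eq_sub_integral_phi hw hw1 hf) hδ.le
    (fun N a b U hU hD => norm_commutator_le_of_eq_sub_integral_phi hw hw1 hint hf hδ hU hD)
    hA hB hAB
end

section
/- There exists a constant C > 0 with the following property. Let f : ℝ → ℝ be a continuous nondecreasing function such that f(t) = 0 for all t ≤ 0, the restriction of f to [0, ∞) is concave, f is bounded with M := sup f > 0, and f has a finite positive right derivative a := f'₊(0) at 0. Then for every δ with 0 < δ < M/(3a) and all bounded self-adjoint operators A, B on a complex Hilbert space with ‖A − B‖ ≤ δ, one has ‖f(A) − f(B)‖ ≤ C · a · δ · log(log(M/(a·δ))). -/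
open MeasureTheory ENNReal

section SchurMultipliers

variable {ι κ : Type} [Fintype ι] [Fintype κ]

/-- The Euclidean norm of a finite family of complex numbers. -/
noncomputable def euclNorm (u : ι → ℂ) : ℝ := √(∑ i, ‖u i‖ ^ 2)

lemma euclNorm_nonneg (u : ι → ℂ) : 0 ≤ euclNorm u := Real.sqrt_nonneg _

lemma euclNorm_sq (u : ι → ℂ) : euclNorm u ^ 2 = ∑ i, ‖u i‖ ^ 2 :=
  Real.sq_sqrt (Finset.sum_nonneg fun _ _ => sq_nonneg _)

lemma euclNorm_mono {u v : ι → ℂ} (h : ∀ i, ‖u i‖ ≤ ‖v i‖) : euclNorm u ≤ euclNorm v :=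
  Real.sqrt_le_sqrt (Finset.sum_le_sum fun i _ => pow_le_pow_left₀ (norm_nonneg _) (h i) 2)

/-- The bilinear form with matrix `D` is bounded by `c` for the Euclidean norms. -/
def FormLE (D : ι → κ → ℂ) (c : ℝ) : Prop :=
  ∀ (u : ι → ℂ) (v : κ → ℂ),
    ‖∑ i, ∑ j, u i * D i j * v j‖ ≤ c * (euclNorm u * euclNorm v)

lemma FormLE.mono {D : ι → κ → ℂ} {c d : ℝ} (h : FormLE D c) (hcd : c ≤ d) : FormLE D d :=
  fun u v => (h u v).trans
    (mul_le_mul_of_nonneg_right hcd (mul_nonneg (euclNorm_nonneg u) (euclNorm_nonneg v)))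

lemma FormLE.add {D E : ι → κ → ℂ} {c d : ℝ} (hD : FormLE D c) (hE : FormLE E d) :
    FormLE (fun i j => D i j + E i j) (c + d) := fun u v => by
  have : ∑ i, ∑ j, u i * (D i j + E i j) * v j
      = ∑ i, ∑ j, u i * D i j * v j + ∑ i, ∑ j, u i * E i j * v j := by
    simp only [← Finset.sum_add_distrib]
    exact Finset.sum_congr rfl fun i _ => Finset.sum_congr rfl fun j _ => by ring
  rw [this, add_mul]
  exact (norm_add_le _ _).trans (add_le_add (hD u v) (hE u v))

lemma FormLE.const_mul {D : ι → κ → ℂ} {c : ℝ} (hD : FormLE D c) (a : ℂ) :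
    FormLE (fun i j => a * D i j) (‖a‖ * c) := fun u v => by
  have : ∑ i, ∑ j, u i * (a * D i j) * v j = a * ∑ i, ∑ j, u i * D i j * v j := by
    simp only [Finset.mul_sum]
    exact Finset.sum_congr rfl fun i _ => Finset.sum_congr rfl fun j _ => by ring
  rw [this, norm_mul, mul_assoc]
  exact mul_le_mul_of_nonneg_left (hD u v) (norm_nonneg a)

lemma FormLE.zero {c : ℝ} (hc : 0 ≤ c) : FormLE (fun (_ : ι) (_ : κ) => 0) c := fun u v => by
  simpa using mul_nonneg hc (mul_nonneg (euclNorm_nonneg u) (euclNorm_nonneg v))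

lemma FormLE.neg {D : ι → κ → ℂ} {c : ℝ} (hD : FormLE D c) :
    FormLE (fun i j => - D i j) c := by
  simpa using hD.const_mul (-1)

lemma norm_ofReal_mul_le {φ : ℝ} (hφ : |φ| ≤ 1) (z : ℂ) : ‖(φ : ℂ) * z‖ ≤ ‖z‖ := by
  rw [norm_mul, Complex.norm_real, Real.norm_eq_abs]
  exact mul_le_of_le_one_left (norm_nonneg z) hφ

lemma FormLE.diag_mul {D : ι → κ → ℂ} {c : ℝ} (hc : 0 ≤ c) (hD : FormLE D c) (φ : ι → ℝ)
    (hφ : ∀ i j, D i j ≠ 0 → |φ i| ≤ 1) : FormLE (fun i j => φ i * D i j) c := fun u v => by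
  classical
  have : ∑ i, ∑ j, u i * (φ i * D i j) * v j
      = ∑ i, ∑ j, (((if |φ i| ≤ 1 then φ i else 0 : ℝ) : ℂ) * u i) * D i j * v j := by
    refine Finset.sum_congr rfl fun i _ => Finset.sum_congr rfl fun j _ => ?_
    by_cases h : D i j = 0
    · simp [h]
    · rw [if_pos (hφ i j h)]; ring
  rw [this]
  refine (hD _ v).trans (mul_le_mul_of_nonneg_left (mul_le_mul_of_nonneg_right
    (euclNorm_mono fun i => norm_ofReal_mul_le ?_ _) (euclNorm_nonneg v)) hc)
  split_ifs with h
  · exact h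
  · simp

lemma FormLE.mul_diag {D : ι → κ → ℂ} {c : ℝ} (hc : 0 ≤ c) (hD : FormLE D c) (ψ : κ → ℝ)
    (hψ : ∀ i j, D i j ≠ 0 → |ψ j| ≤ 1) : FormLE (fun i j => ψ j * D i j) c := fun u v => by
  classical
  have : ∑ i, ∑ j, u i * (ψ j * D i j) * v j
      = ∑ i, ∑ j, u i * D i j * (((if |ψ j| ≤ 1 then ψ j else 0 : ℝ) : ℂ) * v j) := by
    refine Finset.sum_congr rfl fun i _ => Finset.sum_congr rfl fun j _ => ?_
    by_cases h : D i j = 0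
    · simp [h]
    · rw [if_pos (hψ i j h)]; ring
  rw [this]
  refine (hD u _).trans (mul_le_mul_of_nonneg_left (mul_le_mul_of_nonneg_left
    (euclNorm_mono fun i => norm_ofReal_mul_le ?_ _) (euclNorm_nonneg u)) hc)
  split_ifs with h
  · exact h
  · simp

lemma FormLE.diag_mul_of_le {D : ι → κ → ℂ} {c b : ℝ} (hc : 0 ≤ c) (hb : 0 ≤ b)
    (hD : FormLE D c) (φ : ι → ℝ) (hφ : ∀ i, |φ i| ≤ b) :
    FormLE (fun i j => φ i * D i j) (b * c) := by
  rcases hb.eq_or_lt with rfl | hb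
  · have h0 : ∀ i, φ i = 0 := fun i => abs_nonpos_iff.1 (hφ i)
    simpa [h0] using FormLE.zero le_rfl
  · have h := (hD.diag_mul hc (fun i => φ i / b) fun i _ _ => by
      rw [abs_div, abs_of_pos hb, div_le_one hb]; exact hφ i).const_mul b
    rw [Complex.norm_real, Real.norm_eq_abs, abs_of_pos hb] at h
    have hb' : (b : ℂ) ≠ 0 := Complex.ofReal_ne_zero.2 hb.ne'
    convert h using 3
    push_cast
    field_simp

lemma FormLE.mul_diag_of_le {D : ι → κ → ℂ} {c b : ℝ} (hc : 0 ≤ c) (hb : 0 ≤ b)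
    (hD : FormLE D c) (ψ : κ → ℝ) (hψ : ∀ j, |ψ j| ≤ b) :
    FormLE (fun i j => ψ j * D i j) (b * c) := by
  rcases hb.eq_or_lt with rfl | hb
  · have h0 : ∀ j, ψ j = 0 := fun j => abs_nonpos_iff.1 (hψ j)
    simpa [h0] using FormLE.zero le_rfl
  · have h := (hD.mul_diag hc (fun j => ψ j / b) fun _ j _ => by
      rw [abs_div, abs_of_pos hb, div_le_one hb]; exact hψ j).const_mul b
    rw [Complex.norm_real, Real.norm_eq_abs, abs_of_pos hb] at h
    have hb' : (b : ℂ) ≠ 0 := Complex.ofReal_ne_zero.2 hb.ne'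
    convert h using 3
    push_cast
    field_simp

/-- Perturbing both arguments of `(i, j) ↦ s i - t j` by at most `b` costs at most `2 * b`. -/
lemma FormLE.perturb {W : ι → κ → ℂ} {c b : ℝ} (hb : 0 ≤ b) (hW : FormLE W 1)
    {s s' : ι → ℝ} {t t' : κ → ℝ} (hs : ∀ i, |s' i - s i| ≤ b) (ht : ∀ j, |t' j - t j| ≤ b)
    (h : FormLE (fun i j => ((s i - t j : ℝ) : ℂ) * W i j) c) :
    FormLE (fun i j => ((s' i - t' j : ℝ) : ℂ) * W i j) (c + 2 * b) := by
  have h1 := hW.diag_mul_of_le zero_le_one hb _ hs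
  have h2 := (hW.mul_diag_of_le zero_le_one hb _ ht).neg
  convert (h.add (h1.add h2)) using 3
  · push_cast; ring
  · ring

lemma FormLE.of_tendsto {D : ι → κ → ℂ} {E : ℕ → ι → κ → ℂ} {c : ℝ} (hE : ∀ n, FormLE (E n) c)
    (h : ∀ i j, Filter.Tendsto (fun n => E n i j) Filter.atTop (nhds (D i j))) :
    FormLE D c := fun u v =>
  le_of_tendsto (tendsto_finsetSum _ fun i _ => tendsto_finsetSum _ fun j _ =>
    ((h i j).const_mul (u i)).mul_const (v j)).norm (Filter.Eventually.of_forall fun n => hE n u v)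

/-- A matrix which is block diagonal is bounded by the maximum of the bounds of its blocks. -/
lemma FormLE.add_of_blockDiag {D E : ι → κ → ℂ} {c : ℝ} (hc : 0 ≤ c) (hD : FormLE D c)
    (hE : FormLE E c) (p : ι → Prop) (q : κ → Prop) (hDs : ∀ i j, D i j ≠ 0 → p i ∧ q j)
    (hEs : ∀ i j, E i j ≠ 0 → ¬ p i ∧ ¬ q j) : FormLE (fun i j => D i j + E i j) c :=
    fun u v => by
  classical
  set u₁ : ι → ℂ := fun i => if p i then u i else 0 with hu₁
  set u₂ : ι → ℂ := fun i => if p i then 0 else u i with hu₂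
  set v₁ : κ → ℂ := fun j => if q j then v j else 0 with hv₁
  set v₂ : κ → ℂ := fun j => if q j then 0 else v j with hv₂
  have key : ∑ i, ∑ j, u i * (D i j + E i j) * v j
      = ∑ i, ∑ j, u₁ i * D i j * v₁ j + ∑ i, ∑ j, u₂ i * E i j * v₂ j := by
    simp only [← Finset.sum_add_distrib]
    refine Finset.sum_congr rfl fun i _ => Finset.sum_congr rfl fun j _ => ?_
    have hd : D i j = 0 ∨ (p i ∧ q j) := by
      by_cases h : D i j = 0
      · exact .inl h
      · exact .inr (hDs i j h)
    have he : E i j = 0 ∨ (¬ p i ∧ ¬ q j) := by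
      by_cases h : E i j = 0
      · exact .inl h
      · exact .inr (hEs i j h)
    by_cases hp : p i <;> by_cases hq : q j <;> simp_all
  have hu : euclNorm u₁ ^ 2 + euclNorm u₂ ^ 2 = euclNorm u ^ 2 := by
    simp only [euclNorm_sq, ← Finset.sum_add_distrib]
    refine Finset.sum_congr rfl fun i _ => ?_
    by_cases hp : p i <;> simp [hu₁, hu₂, hp]
  have hv : euclNorm v₁ ^ 2 + euclNorm v₂ ^ 2 = euclNorm v ^ 2 := by
    simp only [euclNorm_sq, ← Finset.sum_add_distrib]
    refine Finset.sum_congr rfl fun j _ => ?_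
    by_cases hq : q j <;> simp [hv₁, hv₂, hq]
  rw [key]
  refine (norm_add_le _ _).trans ((add_le_add (hD u₁ v₁) (hE u₂ v₂)).trans ?_)
  rw [← mul_add]
  refine mul_le_mul_of_nonneg_left (abs_le_of_sq_le_sq' ?_ (mul_nonneg (euclNorm_nonneg u)
    (euclNorm_nonneg v))).2 hc
  rw [mul_pow, ← hu, ← hv]
  nlinarith [sq_nonneg (euclNorm u₁ * euclNorm v₂ - euclNorm u₂ * euclNorm v₁)]

/-- The Haagerup-type sufficient condition for a Schur multiplier to be contractive. -/
lemma FormLE.schur_mul {D : ι → κ → ℂ} {c : ℝ} (hc : 0 ≤ c) (hD : FormLE D c) (n : ℕ)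
    (φ : ℕ → ι → ℝ) (ψ : ℕ → κ → ℝ) (hφ : ∀ i, ∑ k ∈ Finset.range n, φ k i ^ 2 ≤ 1)
    (hψ : ∀ j, ∑ k ∈ Finset.range n, ψ k j ^ 2 ≤ 1) :
    FormLE (fun i j => ((∑ k ∈ Finset.range n, φ k i * ψ k j : ℝ) : ℂ) * D i j) c :=
    fun u v => by
  have key : ∑ i, ∑ j, u i * (((∑ k ∈ Finset.range n, φ k i * ψ k j : ℝ) : ℂ) * D i j) * v j
      = ∑ k ∈ Finset.range n, ∑ i, ∑ j, (φ k i * u i) * D i j * (ψ k j * v j) := by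
    symm
    rw [Finset.sum_comm]
    refine Finset.sum_congr rfl fun i _ => ?_
    rw [Finset.sum_comm]
    refine Finset.sum_congr rfl fun j _ => ?_
    push_cast
    rw [Finset.sum_mul, Finset.mul_sum, Finset.sum_mul]
    exact Finset.sum_congr rfl fun k _ => by ring
  have bound : ∀ {α : Type} [Fintype α] (θ : ℕ → α → ℝ) (w : α → ℂ),
      (∀ a, ∑ k ∈ Finset.range n, θ k a ^ 2 ≤ 1) →
      ∑ k ∈ Finset.range n, euclNorm (fun a => (θ k a : ℂ) * w a) ^ 2 ≤ euclNorm w ^ 2 := by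
    intro α _ θ w h
    simp only [euclNorm_sq, norm_mul, mul_pow, Complex.norm_real, Real.norm_eq_abs, sq_abs]
    rw [Finset.sum_comm]
    refine Finset.sum_le_sum fun a _ => ?_
    rw [← Finset.sum_mul]
    exact mul_le_of_le_one_left (sq_nonneg _) (h a)
  rw [key]
  refine (norm_sum_le _ _).trans ((Finset.sum_le_sum fun k _ => hD _ _).trans ?_)
  rw [← Finset.mul_sum]
  refine mul_le_mul_of_nonneg_left ((Real.sum_mul_le_sqrt_mul_sqrt _ _ _).trans ?_) hc
  exact mul_le_mul (Real.sqrt_le_iff.2 ⟨euclNorm_nonneg u, bound φ u hφ⟩)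
    (Real.sqrt_le_iff.2 ⟨euclNorm_nonneg v, bound ψ v hψ⟩) (Real.sqrt_nonneg _)
    (euclNorm_nonneg u)

end SchurMultipliers

section Kernels

/-- Schur multiplication by the kernel `k`, restricted to matrices supported on the rows with
node in `I` and the columns with node in `J`, has norm at most `c`. -/
def SchurOn (k : ℝ → ℝ → ℝ) (I J : Set ℝ) (c : ℝ) : Prop :=
  ∀ (ι κ : Type) [Fintype ι] [Fintype κ] (x : ι → ℝ) (y : κ → ℝ) (D : ι → κ → ℂ) (d : ℝ),
    0 ≤ d → FormLE D d → (∀ i j, D i j ≠ 0 → x i ∈ I ∧ y j ∈ J) →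
    FormLE (fun i j => (k (x i) (y j) : ℂ) * D i j) (c * d)

variable {k l : ℝ → ℝ → ℝ} {I J I₁ I₂ J₁ J₂ : Set ℝ} {c d : ℝ}

lemma SchurOn.congr (h : SchurOn k I J c) (hkl : ∀ x ∈ I, ∀ y ∈ J, l x y = k x y) :
    SchurOn l I J c := by
  intro ι κ _ _ x y D d hd hD hs
  convert h ι κ x y D d hd hD hs using 3 with i j
  by_cases hij : D i j = 0
  · simp [hij]
  · rw [hkl _ (hs i j hij).1 _ (hs i j hij).2]

lemma SchurOn.mono (h : SchurOn k I J c) (hcd : c ≤ d) : SchurOn k I J d :=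
  fun ι κ _ _ x y D e he hD hs =>
    (h ι κ x y D e he hD hs).mono (mul_le_mul_of_nonneg_right hcd he)

lemma SchurOn.subset (h : SchurOn k I J c) (hI : I₁ ⊆ I) (hJ : J₁ ⊆ J) : SchurOn k I₁ J₁ c :=
  fun ι κ _ _ x y D d hd hD hs =>
    h ι κ x y D d hd hD fun i j hij => ⟨hI (hs i j hij).1, hJ (hs i j hij).2⟩

lemma SchurOn.comp (h : SchurOn k I J c) (f g : ℝ → ℝ) (hf : ∀ x ∈ I₁, f x ∈ I)
    (hg : ∀ y ∈ J₁, g y ∈ J) : SchurOn (fun x y => k (f x) (g y)) I₁ J₁ c :=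
  fun ι κ _ _ x y D d hd hD hs =>
    h ι κ (fun i => f (x i)) (fun j => g (y j)) D d hd hD fun i j hij =>
      ⟨hf _ (hs i j hij).1, hg _ (hs i j hij).2⟩

lemma SchurOn.zero : SchurOn (fun _ _ => 0) I J 0 := by
  intro ι κ _ _ x y D d hd hD hs
  simpa using FormLE.zero le_rfl

lemma SchurOn.one : SchurOn (fun _ _ => 1) I J 1 := by
  intro ι κ _ _ x y D d hd hD hs
  simpa using hD

lemma SchurOn.one_sub (h : SchurOn k I J c) : SchurOn (fun x y => 1 - k x y) I J (1 + c) := by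
  intro ι κ _ _ x y D d hd hD hs
  convert hD.add (h ι κ x y D d hd hD hs).neg using 3
  · push_cast; ring
  · ring

lemma SchurOn.left_mul (h : SchurOn k I J c) (hc : 0 ≤ c) (φ : ℝ → ℝ) (hφ : ∀ x ∈ I, |φ x| ≤ 1) :
    SchurOn (fun x y => φ x * k x y) I J c := by
  intro ι κ _ _ x y D d hd hD hs
  convert (h ι κ x y D d hd hD hs).diag_mul (mul_nonneg hc hd) (fun i => φ (x i))
    (fun i j hij => hφ _ (hs i j (right_ne_zero_of_mul hij)).1) using 3
  push_cast; ring

lemma SchurOn.right_mul (h : SchurOn k I J c) (hc : 0 ≤ c) (ψ : ℝ → ℝ) (hψ : ∀ y ∈ J, |ψ y| ≤ 1) :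
    SchurOn (fun x y => ψ y * k x y) I J c := by
  intro ι κ _ _ x y D d hd hD hs
  convert (h ι κ x y D d hd hD hs).mul_diag (mul_nonneg hc hd) (fun j => ψ (y j))
    (fun i j hij => hψ _ (hs i j (right_ne_zero_of_mul hij)).2) using 3
  push_cast; ring

open Classical in
lemma SchurOn.union_right (h₁ : SchurOn k I J₁ c) (h₂ : SchurOn k I J₂ d) :
    SchurOn k I (J₁ ∪ J₂) (c + d) := by
  intro ι κ _ _ x y D e he hD hs
  have H₁ := h₁ ι κ x y _ e he (hD.mul_diag he (fun j => if y j ∈ J₁ then 1 else 0)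
    fun i j _ => by split_ifs <;> simp) fun i j hij => by
      have hj : y j ∈ J₁ := by by_contra hj; simp [hj] at hij
      exact ⟨(hs i j (right_ne_zero_of_mul hij)).1, hj⟩
  have H₂ := h₂ ι κ x y _ e he (hD.mul_diag he (fun j => if y j ∈ J₁ then 0 else 1)
    fun i j _ => by split_ifs <;> simp) fun i j hij => by
      have hj : y j ∉ J₁ := by intro hj; simp [hj] at hij
      have := hs i j (right_ne_zero_of_mul hij)
      exact ⟨this.1, this.2.resolve_left hj⟩
  convert H₁.add H₂ using 3 with i j
  · by_cases hj : y j ∈ J₁ <;> simp [hj]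
  · ring

open Classical in
lemma SchurOn.union_left (h₁ : SchurOn k I₁ J c) (h₂ : SchurOn k I₂ J d) :
    SchurOn k (I₁ ∪ I₂) J (c + d) := by
  intro ι κ _ _ x y D e he hD hs
  have H₁ := h₁ ι κ x y _ e he (hD.diag_mul he (fun i => if x i ∈ I₁ then 1 else 0)
    fun i j _ => by split_ifs <;> simp) fun i j hij => by
      have hj : x i ∈ I₁ := by by_contra hj; simp [hj] at hij
      exact ⟨hj, (hs i j (right_ne_zero_of_mul hij)).2⟩
  have H₂ := h₂ ι κ x y _ e he (hD.diag_mul he (fun i => if x i ∈ I₁ then 0 else 1)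
    fun i j _ => by split_ifs <;> simp) fun i j hij => by
      have hj : x i ∉ I₁ := by intro hj; simp [hj] at hij
      have := hs i j (right_ne_zero_of_mul hij)
      exact ⟨this.1.resolve_left hj, this.2⟩
  convert H₁.add H₂ using 3 with i j
  · by_cases hj : x i ∈ I₁ <;> simp [hj]
  · ring

open Classical in
/-- The diagonal blocks of a `2 × 2` block decomposition cost only the maximum of their bounds. -/
lemma SchurOn.union_union {e e' : ℝ} (hc : 0 ≤ c) (h₁₁ : SchurOn k I₁ J₁ c)
    (h₂₂ : SchurOn k I₂ J₂ c) (h₁₂ : SchurOn k I₁ J₂ e) (h₂₁ : SchurOn k I₂ J₁ e') :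
    SchurOn k (I₁ ∪ I₂) (J₁ ∪ J₂) (c + e + e') := by
  intro ι κ _ _ x y D d hd hD hs
  have cut : ∀ (p : ι → Prop) (q : κ → Prop), FormLE (fun i j =>
      ((if q j then 1 else 0 : ℝ) : ℂ) * (((if p i then 1 else 0 : ℝ) : ℂ) * D i j)) d := by
    intro p q
    refine (hD.diag_mul hd (fun i => if p i then 1 else 0) fun i j _ => ?_).mul_diag hd
      (fun j => if q j then 1 else 0) fun i j _ => ?_ <;> split_ifs <;> simp
  have H₁₁ := h₁₁ ι κ x y _ d hd (cut (fun i => x i ∈ I₁) (fun j => y j ∈ J₁))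
    fun i j hij => by
      by_contra h
      rw [not_and_or] at h
      rcases h with h | h <;> simp [h] at hij
  have H₂₂ := h₂₂ ι κ x y _ d hd (cut (fun i => x i ∉ I₁) (fun j => y j ∉ J₁))
    fun i j hij => by
      have h := hs i j (right_ne_zero_of_mul (right_ne_zero_of_mul hij))
      refine ⟨h.1.resolve_left fun h' => ?_, h.2.resolve_left fun h' => ?_⟩ <;> simp [h'] at hij
  have H₁₂ := h₁₂ ι κ x y _ d hd (cut (fun i => x i ∈ I₁) (fun j => y j ∉ J₁))
    fun i j hij => by
      have h := hs i j (right_ne_zero_of_mul (right_ne_zero_of_mul hij))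
      refine ⟨by_contra fun h' => ?_, h.2.resolve_left fun h' => ?_⟩ <;> simp [h'] at hij
  have H₂₁ := h₂₁ ι κ x y _ d hd (cut (fun i => x i ∉ I₁) (fun j => y j ∈ J₁))
    fun i j hij => by
      have h := hs i j (right_ne_zero_of_mul (right_ne_zero_of_mul hij))
      refine ⟨h.1.resolve_left fun h' => ?_, by_contra fun h' => ?_⟩ <;> simp [h'] at hij
  have diag := H₁₁.add_of_blockDiag (mul_nonneg hc hd) H₂₂ (fun i => x i ∈ I₁) (fun j => y j ∈ J₁)
    (fun i j hij => by
      by_contra h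
      rw [not_and_or] at h
      rcases h with h | h <;> simp [h] at hij)
    (fun i j hij => by
      refine ⟨fun h => ?_, fun h => ?_⟩ <;> simp [h] at hij)
  convert (diag.add H₁₂).add H₂₁ using 3 with i j
  · by_cases hi : x i ∈ I₁ <;> by_cases hj : y j ∈ J₁ <;> simp [hi, hj]
  · ring

lemma sum_range_sq_one_sub_mul_pow_le {p : ℝ} (h0 : 0 ≤ p) (h1 : p ≤ 1) (n : ℕ) :
    ∑ k ∈ Finset.range n, ((1 - p) * p ^ k) ^ 2 ≤ 1 := by
  have h : (∑ k ∈ Finset.range n, (p ^ 2) ^ k) * (1 - p ^ 2) = 1 - (p ^ 2) ^ n :=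
    geom_sum_mul_neg _ _
  have hS : 0 ≤ ∑ k ∈ Finset.range n, (p ^ 2) ^ k :=
    Finset.sum_nonneg fun k _ => by positivity
  have h2 : (0 : ℝ) ≤ (p ^ 2) ^ n := by positivity
  have : ∑ k ∈ Finset.range n, ((1 - p) * p ^ k) ^ 2
      = (1 - p) ^ 2 * ∑ k ∈ Finset.range n, (p ^ 2) ^ k := by
    rw [Finset.mul_sum]
    exact Finset.sum_congr rfl fun k _ => by ring
  rw [this]
  nlinarith [mul_nonneg hS (mul_nonneg h0 (sub_nonneg.2 h1))]

lemma SchurOn.const_div_add_abs (hc : 0 < c) :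
    SchurOn (fun x y => c / (c + |x| + |y|)) Set.univ Set.univ 1 := by
  intro ι κ _ _ x y D d hd hD _
  set p : ℝ → ℝ := fun t => |t| / (c + |t|) with hp
  have hp0 : ∀ t, 0 ≤ p t := fun t => by positivity
  have hp1 : ∀ t, p t < 1 := fun t => by
    rw [hp, div_lt_one (by positivity)]; linarith
  rw [one_mul]
  refine FormLE.of_tendsto (E := fun n i j => ((∑ k ∈ Finset.range n,
    ((1 - p (x i)) * p (x i) ^ k) * ((1 - p (y j)) * p (y j) ^ k) : ℝ) : ℂ) * D i j) (fun n =>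
    hD.schur_mul hd n (fun k i => (1 - p (x i)) * p (x i) ^ k)
      (fun k j => (1 - p (y j)) * p (y j) ^ k)
      (fun i => sum_range_sq_one_sub_mul_pow_le (hp0 _) (hp1 _).le n)
      (fun j => sum_range_sq_one_sub_mul_pow_le (hp0 _) (hp1 _).le n)) fun i j => ?_
  refine Filter.Tendsto.mul_const _ (Complex.continuous_ofReal.continuousAt.tendsto.comp ?_)
  have hlt : p (x i) * p (y j) < 1 :=
    mul_lt_one_of_nonneg_of_lt_one_left (hp0 _) (hp1 _) (hp1 _).le
  have hs := ((hasSum_geometric_of_lt_one (mul_nonneg (hp0 (x i)) (hp0 (y j))) hlt).mul_left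
    ((1 - p (x i)) * (1 - p (y j)))).tendsto_sum_nat
  have hval : c / (c + |x i| + |y j|)
      = (1 - p (x i)) * (1 - p (y j)) * (1 - p (x i) * p (y j))⁻¹ := by
    have e1 : 0 < c + |x i| := by positivity
    have e2 : 0 < c + |y j| := by positivity
    have e3 : 0 < c + |x i| + |y j| := by positivity
    have h1 : 1 - p (x i) = c / (c + |x i|) := by rw [hp]; field_simp; ring
    have h2 : 1 - p (y j) = c / (c + |y j|) := by rw [hp]; field_simp; ring
    have h3 : 1 - p (x i) * p (y j)
        = c * (c + |x i| + |y j|) / ((c + |x i|) * (c + |y j|)) := by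
      rw [hp]; field_simp; ring
    rw [h1, h2, h3]
    field_simp
  beta_reduce
  rw [hval]
  refine hs.congr fun n => Finset.sum_congr rfl fun k _ => by rw [mul_pow]; ring

/-- Shifting the base point of `SchurOn.const_div_add_abs` to `a` and `b`. -/
lemma SchurOn.const_div_add {a b : ℝ} (hc : 0 < c) :
    SchurOn (fun x y => c / (c + |x - a| + |y - b|)) I J 1 :=
  (SchurOn.const_div_add_abs hc).comp (fun x => x - a) (fun y => y - b)
    (fun _ _ => Set.mem_univ _) (fun _ _ => Set.mem_univ _)

lemma SchurOn.div_add_of_le_le (hc : 0 < c) :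
    SchurOn (fun x y => x / (x + y)) (Set.Ioc 0 c) (Set.Ici c) 1 := by
  refine ((SchurOn.const_div_add (a := 0) (b := c) hc).left_mul zero_le_one (fun x => x / c)
    fun x hx => ?_).congr fun x hx y hy => ?_
  · rw [abs_of_pos (div_pos hx.1 hc), div_le_one hc]; exact hx.2
  · have h1 : 0 < x := hx.1
    have h2 : c ≤ y := hy
    rw [sub_zero, abs_of_pos h1, abs_of_nonneg (sub_nonneg.2 h2),
      show c + x + (y - c) = x + y by ring]
    have : 0 < x + y := by linarith
    field_simp

lemma SchurOn.div_add_of_ge_ge (hc : 0 < c) :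
    SchurOn (fun x y => x / (x + y)) (Set.Ici c) (Set.Ioc 0 c) 2 := by
  refine (((SchurOn.const_div_add (a := c) (b := 0) hc).right_mul zero_le_one (fun y => y / c)
    fun y hy => ?_).one_sub.mono (by norm_num)).congr fun x hx y hy => ?_
  · rw [abs_of_pos (div_pos hy.1 hc), div_le_one hc]; exact hy.2
  · have h1 : 0 < y := hy.1
    have h2 : c ≤ x := hx
    rw [sub_zero, abs_of_pos h1, abs_of_nonneg (sub_nonneg.2 h2),
      show c + (x - c) + y = x + y by ring]
    have : 0 < x + y := by linarith
    field_simp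
    ring

/-- The kernel `x / (x + y)` on a square of logarithmic size `2 ^ m`. -/
lemma SchurOn.div_add_Icc (m : ℕ) : ∀ s : ℝ, 0 < s →
    SchurOn (fun x y => x / (x + y)) (Set.Icc s (s * 2 ^ 2 ^ m)) (Set.Icc s (s * 2 ^ 2 ^ m))
      (3 * m + 1) := by
  induction m with
  | zero =>
    intro s hs
    refine (((SchurOn.const_div_add (a := s) (b := s) (c := 2 * s) (by positivity)).left_mul
      zero_le_one (fun x => x / (2 * s)) fun x hx => ?_).mono (by simp)).congr
      fun x hx y hy => ?_
    · have h1 : s ≤ x := hx.1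
      have h2 : x ≤ s * 2 ^ 2 ^ 0 := hx.2
      norm_num at h2
      rw [abs_of_nonneg (div_nonneg (by linarith) (by positivity)), div_le_one (by positivity)]
      linarith
    · have h1 : s ≤ x := hx.1
      have h2 : s ≤ y := hy.1
      rw [abs_of_nonneg (sub_nonneg.2 h1), abs_of_nonneg (sub_nonneg.2 h2),
        show 2 * s + (x - s) + (y - s) = x + y by ring]
      have : 0 < x + y := by linarith
      field_simp
  | succ m ih =>
    intro s hs
    set R : ℝ := 2 ^ 2 ^ m with hR
    have hR1 : 1 ≤ R := one_le_pow₀ (by norm_num)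
    have hRR : (2 : ℝ) ^ 2 ^ (m + 1) = R * R := by rw [hR, ← pow_add, pow_succ]; ring_nf
    have hsR : s ≤ s * R := le_mul_of_one_le_right hs.le hR1
    have hsR' : s * R ≤ s * R * R := le_mul_of_one_le_right (by positivity) hR1
    rw [hRR, ← mul_assoc, ← Set.Icc_union_Icc_eq_Icc hsR hsR']
    have lo : Set.Icc s (s * R) ⊆ Set.Ioc 0 (s * R) := fun x hx => ⟨hs.trans_le hx.1, hx.2⟩
    have hi : Set.Icc (s * R) (s * R * R) ⊆ Set.Ici (s * R) := fun x hx => hx.1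
    have hpos : 0 < s * R := by positivity
    refine (SchurOn.union_union (by positivity) (ih s hs) (ih (s * R) hpos)
      ((SchurOn.div_add_of_le_le hpos).subset lo hi)
      ((SchurOn.div_add_of_ge_ge hpos).subset hi lo)).mono ?_
    push_cast
    linarith

lemma SchurOn.div_add_Icc_Ici (m : ℕ) :
    SchurOn (fun x y => x / (x + y)) (Set.Icc 1 (2 ^ 2 ^ m)) (Set.Ici 1) (3 * m + 2) := by
  have h1 : (1 : ℝ) ≤ 2 ^ 2 ^ m := one_le_pow₀ (by norm_num)
  rw [← Set.Icc_union_Ici_eq_Ici h1]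
  have h := SchurOn.div_add_Icc m 1 one_pos
  rw [one_mul] at h
  refine (h.union_right ((SchurOn.div_add_of_le_le (by positivity)).subset
    (fun x hx => ⟨by linarith [hx.1], hx.2⟩) subset_rfl)).mono (by linarith)

lemma SchurOn.div_add_Ici_Icc (m : ℕ) :
    SchurOn (fun x y => x / (x + y)) (Set.Ici 1) (Set.Icc 1 (2 ^ 2 ^ m)) (3 * m + 3) := by
  have h1 : (1 : ℝ) ≤ 2 ^ 2 ^ m := one_le_pow₀ (by norm_num)
  rw [← Set.Icc_union_Ici_eq_Ici h1]
  have h := SchurOn.div_add_Icc m 1 one_pos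
  rw [one_mul] at h
  refine (h.union_left ((SchurOn.div_add_of_ge_ge (by positivity)).subset
    subset_rfl (fun x hx => ⟨by linarith [hx.1], hx.2⟩))).mono (by linarith)

end Kernels

section Clip

/-- The divided difference of `f` on `I ×ˢ J` is a Schur multiplier of norm at most `c`. -/
def DividedDiffLE (f : ℝ → ℝ) (I J : Set ℝ) (c : ℝ) : Prop :=
  ∃ k : ℝ → ℝ → ℝ, SchurOn k I J c ∧ ∀ x ∈ I, ∀ y ∈ J, k x y * (x - y) = f x - f y

variable {f : ℝ → ℝ} {I J I₁ I₂ J₁ J₂ : Set ℝ} {c d : ℝ}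

open Classical in
lemma DividedDiffLE.union_right (h₁ : DividedDiffLE f I J₁ c) (h₂ : DividedDiffLE f I J₂ d) :
    DividedDiffLE f I (J₁ ∪ J₂) (c + d) := by
  obtain ⟨k₁, hk₁, e₁⟩ := h₁
  obtain ⟨k₂, hk₂, e₂⟩ := h₂
  refine ⟨fun x y => if y ∈ J₁ then k₁ x y else k₂ x y, ?_, fun x hx y hy => ?_⟩
  · rw [← Set.union_sdiff_self]
    exact (hk₁.congr fun x _ y hy => if_pos hy).union_right
      ((hk₂.subset subset_rfl Set.sdiff_subset).congr fun x _ y hy => if_neg hy.2)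
  · by_cases h : y ∈ J₁
    · simpa [h] using e₁ x hx y h
    · simpa [h] using e₂ x hx y (hy.resolve_left h)

open Classical in
lemma DividedDiffLE.union_left (h₁ : DividedDiffLE f I₁ J c) (h₂ : DividedDiffLE f I₂ J d) :
    DividedDiffLE f (I₁ ∪ I₂) J (c + d) := by
  obtain ⟨k₁, hk₁, e₁⟩ := h₁
  obtain ⟨k₂, hk₂, e₂⟩ := h₂
  refine ⟨fun x y => if x ∈ I₁ then k₁ x y else k₂ x y, ?_, fun x hx y hy => ?_⟩
  · rw [← Set.union_sdiff_self]
    exact (hk₁.congr fun x hx y _ => if_pos hx).union_left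
      ((hk₂.subset Set.sdiff_subset subset_rfl).congr fun x hx y _ => if_neg hx.2)
  · by_cases h : x ∈ I₁
    · simpa [h] using e₁ x h y hy
    · simpa [h] using e₂ x (hx.resolve_left h) y hy

lemma DividedDiffLE.formLE {ι κ : Type} [Fintype ι] [Fintype κ] (h : DividedDiffLE f I J c)
    {x : ι → ℝ} {y : κ → ℝ} (hx : ∀ i, x i ∈ I) (hy : ∀ j, y j ∈ J) {W : ι → κ → ℂ} (hd : 0 ≤ d)
    (hW : FormLE (fun i j => ((x i - y j : ℝ) : ℂ) * W i j) d) :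
    FormLE (fun i j => ((f (x i) - f (y j) : ℝ) : ℂ) * W i j) (c * d) := by
  obtain ⟨k, hk, e⟩ := h
  convert hk ι κ x y _ d hd hW (fun i j _ => ⟨hx i, hy j⟩) using 3 with i j
  rw [← e _ (hx i) _ (hy j)]
  push_cast
  ring

/-- The projection of the real line onto `[0, T]`. -/
noncomputable def clip (T x : ℝ) : ℝ := max 0 (min x T)

lemma clip_of_nonpos {T x : ℝ} (hx : x ≤ 0) : clip T x = 0 :=
  max_eq_left ((min_le_left _ _).trans hx)

lemma clip_of_mem {T x : ℝ} (h0 : 0 ≤ x) (hx : x ≤ T) : clip T x = x := by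
  rw [clip, min_eq_left hx, max_eq_right h0]

lemma clip_of_ge {T x : ℝ} (hT : 0 ≤ T) (hx : T ≤ x) : clip T x = T := by
  rw [clip, min_eq_right hx, max_eq_right hT]

lemma clip_sub {T : ℝ} (hT : 0 ≤ T) (x : ℝ) : clip T (T - x) = T - clip T x := by
  rcases le_total x 0 with h | h
  · rw [clip_of_nonpos h, clip_of_ge hT (by linarith), sub_zero]
  · rcases le_total x T with h' | h'
    · rw [clip_of_mem h h', clip_of_mem (by linarith) (by linarith)]
    · rw [clip_of_ge hT h', clip_of_nonpos (by linarith), sub_self]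

lemma abs_clip_sub_clip_le (T x y : ℝ) : |clip T x - clip T y| ≤ |x - y| := by
  unfold clip
  refine (abs_max_sub_max_le_max _ _ _ _).trans ?_
  rw [sub_self, abs_zero, max_eq_right (abs_nonneg _)]
  refine (abs_min_sub_min_le_max _ _ _ _).trans ?_
  rw [sub_self, abs_zero, max_eq_left (abs_nonneg _)]

lemma clip_mul {b : ℝ} (hb : 0 ≤ b) (T x : ℝ) : clip (b * T) (b * x) = b * clip T x := by
  rw [clip, clip, mul_max_of_nonneg _ _ hb, mul_min_of_nonneg _ _ hb, mul_zero]

lemma DividedDiffLE.clip_reflect {T : ℝ} (hT : 0 ≤ T) (h : DividedDiffLE (clip T) I J c)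
    (hI : ∀ x ∈ I₁, T - x ∈ I) (hJ : ∀ y ∈ J₁, T - y ∈ J) : DividedDiffLE (clip T) I₁ J₁ c := by
  obtain ⟨k, hk, e⟩ := h
  refine ⟨_, hk.comp (fun x => T - x) (fun y => T - y) hI hJ, fun x hx y hy => ?_⟩
  have := e _ (hI x hx) _ (hJ y hy)
  rw [clip_sub hT, clip_sub hT] at this
  linarith

lemma dividedDiffLE_clip_neg_mid {T : ℝ} {m : ℕ} (hTm : T ≤ 2 ^ 2 ^ m) :
    DividedDiffLE (clip T) (Set.Iic (-1)) (Set.Icc 1 (T - 1)) (3 * m + 4) := by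
  refine ⟨_, ((SchurOn.div_add_Ici_Icc m).comp (fun x => -x) (fun y => y)
    (fun x hx => ?_) (fun y hy => ⟨hy.1, by linarith [hy.2]⟩)).one_sub.mono (by linarith),
    fun x hx y hy => ?_⟩
  · have : x ≤ -1 := hx
    exact Set.mem_Ici.2 (by linarith)
  · have h1 : x ≤ -1 := hx
    have h2 : 1 ≤ y := hy.1
    rw [clip_of_nonpos (by linarith), clip_of_mem (by linarith) (by linarith [hy.2])]
    have : -x + y ≠ 0 := by linarith
    field_simp
    ring

lemma dividedDiffLE_clip_mid_neg {T : ℝ} {m : ℕ} (hTm : T ≤ 2 ^ 2 ^ m) :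
    DividedDiffLE (clip T) (Set.Icc 1 (T - 1)) (Set.Iic (-1)) (3 * m + 2) := by
  refine ⟨_, ((SchurOn.div_add_Icc_Ici m).comp (fun x => x) (fun y => -y)
    (fun x hx => ⟨hx.1, by linarith [hx.2]⟩) (fun y hy => ?_)), fun x hx y hy => ?_⟩
  · have : y ≤ -1 := hy
    exact Set.mem_Ici.2 (by linarith)
  · have h1 : y ≤ -1 := hy
    have h2 : 1 ≤ x := hx.1
    rw [clip_of_nonpos (x := y) (by linarith), clip_of_mem (by linarith) (by linarith [hx.2])]
    have : x + -y ≠ 0 := by linarith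
    field_simp
    ring

lemma dividedDiffLE_clip_neg_pos {T : ℝ} (hT : 0 < T) :
    DividedDiffLE (clip T) (Set.Iic (-1)) (Set.Ici (T + 1)) 1 := by
  refine ⟨_, SchurOn.const_div_add (a := 0) (b := T) hT, fun x hx y hy => ?_⟩
  have h1 : x ≤ -1 := hx
  have h2 : T + 1 ≤ y := hy
  rw [clip_of_nonpos (x := x) (by linarith), clip_of_ge hT.le (by linarith), sub_zero,
    abs_of_nonpos (by linarith), abs_of_nonneg (by linarith),
    show T + -x + (y - T) = y - x by ring]
  have : y - x ≠ 0 := by linarith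
  field_simp
  ring

lemma dividedDiffLE_clip_pos_neg {T : ℝ} (hT : 0 < T) :
    DividedDiffLE (clip T) (Set.Ici (T + 1)) (Set.Iic (-1)) 1 := by
  refine ⟨_, SchurOn.const_div_add (a := T) (b := 0) hT, fun x hx y hy => ?_⟩
  have h1 : y ≤ -1 := hy
  have h2 : T + 1 ≤ x := hx
  rw [clip_of_nonpos (x := y) (by linarith), clip_of_ge hT.le (by linarith), sub_zero,
    abs_of_nonneg (by linarith), abs_of_nonpos (by linarith),
    show T + (x - T) + -y = x - y by ring]
  have : x - y ≠ 0 := by linarith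
  field_simp
  ring

/-- Away from the kinks `0` and `T`, the divided difference of `clip T` is a Schur multiplier
whose norm grows like the iterated logarithm of `T`. -/
lemma dividedDiffLE_clip {T : ℝ} (hT : 0 < T) {m : ℕ} (hTm : T ≤ 2 ^ 2 ^ m) :
    DividedDiffLE (clip T) (Set.Iic (-1) ∪ Set.Icc 1 (T - 1) ∪ Set.Ici (T + 1))
      (Set.Iic (-1) ∪ Set.Icc 1 (T - 1) ∪ Set.Ici (T + 1)) (12 * m + 15) := by
  have mid : ∀ x ∈ Set.Icc 1 (T - 1), T - x ∈ Set.Icc 1 (T - 1) := fun x hx =>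
    ⟨by linarith [hx.2], by linarith [hx.1]⟩
  have pos : ∀ x ∈ Set.Ici (T + 1), T - x ∈ Set.Iic (-1 : ℝ) := fun x hx => by
    have : T + 1 ≤ x := hx
    exact Set.mem_Iic.2 (by linarith)
  have negneg : DividedDiffLE (clip T) (Set.Iic (-1)) (Set.Iic (-1)) 0 :=
    ⟨_, SchurOn.zero, fun x hx y hy => by
      have h1 : x ≤ -1 := hx
      have h2 : y ≤ -1 := hy
      rw [clip_of_nonpos (x := x) (by linarith), clip_of_nonpos (x := y) (by linarith)]
      ring⟩
  have midmid : DividedDiffLE (clip T) (Set.Icc 1 (T - 1)) (Set.Icc 1 (T - 1)) 1 :=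
    ⟨_, SchurOn.one, fun x hx y hy => by
      rw [clip_of_mem (x := x) (by linarith [hx.1]) (by linarith [hx.2]),
        clip_of_mem (x := y) (by linarith [hy.1]) (by linarith [hy.2]), one_mul]⟩
  have negmid := dividedDiffLE_clip_neg_mid hTm
  have midneg := dividedDiffLE_clip_mid_neg hTm
  have neg := (negneg.union_right negmid).union_right (dividedDiffLE_clip_neg_pos hT)
  have middle := (midneg.union_right midmid).union_right (midneg.clip_reflect hT.le mid pos)
  have positive := ((dividedDiffLE_clip_pos_neg hT).union_right
    (negmid.clip_reflect hT.le pos mid)).union_right (negneg.clip_reflect hT.le pos pos)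
  convert (neg.union_left middle).union_left positive using 1
  ring

/-- Moves the points at distance less than `1` from `0` or `T` away from these two kinks. -/
noncomputable def avoidKinks (T x : ℝ) : ℝ :=
  if |x| < 1 then -1 else if |x - T| < 1 then T + 1 else x

lemma abs_avoidKinks_sub_le (T x : ℝ) : |avoidKinks T x - x| ≤ 2 := by
  unfold avoidKinks
  split_ifs with h1 h2
  · rw [abs_lt] at h1; rw [abs_le]; constructor <;> linarith
  · rw [abs_lt] at h2; rw [abs_le]; constructor <;> linarith
  · simp

lemma avoidKinks_mem (T x : ℝ) :
    avoidKinks T x ∈ Set.Iic (-1) ∪ Set.Icc 1 (T - 1) ∪ Set.Ici (T + 1) := by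
  unfold avoidKinks
  split_ifs with h1 h2
  · exact .inl (.inl (Set.mem_Iic.2 le_rfl))
  · exact .inr (Set.mem_Ici.2 le_rfl)
  · rw [not_lt, le_abs] at h1 h2
    rcases h1 with h1 | h1
    · rcases h2 with h2 | h2
      · exact .inr (Set.mem_Ici.2 (by linarith))
      · exact .inl (.inr ⟨h1, by linarith⟩)
    · exact .inl (.inl (Set.mem_Iic.2 (by linarith)))

variable {ι κ : Type} [Fintype ι] [Fintype κ] {x : ι → ℝ} {y : κ → ℝ} {W : ι → κ → ℂ}

lemma formLE_clip {T : ℝ} (hT : 0 ≤ T) {m : ℕ} (hTm : T ≤ 2 ^ 2 ^ m) (hW : FormLE W 1)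
    (hxy : FormLE (fun i j => ((x i - y j : ℝ) : ℂ) * W i j) 1) :
    FormLE (fun i j => ((clip T (x i) - clip T (y j) : ℝ) : ℂ) * W i j) (60 * m + 79) := by
  rcases hT.eq_or_lt with rfl | hT
  · have h0 : ∀ z, clip 0 z = 0 := fun z => max_eq_left (min_le_right _ _)
    simpa [h0] using FormLE.zero (by positivity)
  · have h1 := hW.perturb zero_le_two (fun i => abs_avoidKinks_sub_le T (x i))
      (fun j => abs_avoidKinks_sub_le T (y j)) hxy
    have h2 := (dividedDiffLE_clip hT hTm).formLE (fun i => avoidKinks_mem T (x i))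
      (fun j => avoidKinks_mem T (y j)) (by norm_num) h1
    have near : ∀ z, |clip T z - clip T (avoidKinks T z)| ≤ 2 := fun z =>
      (abs_clip_sub_clip_le _ _ _).trans (by rw [abs_sub_comm]; exact abs_avoidKinks_sub_le T z)
    exact (hW.perturb zero_le_two (fun i => near (x i)) (fun j => near (y j)) h2).mono
      (by linarith)

/-- The growth function `139 + 120 * log (1 + 2 * log (1 + T))` bounding the operator modulus
of continuity of `clip T` at `1`. -/
noncomputable def clipModulus (T : ℝ) : ℝ := 139 + 120 * Real.log (1 + 2 * Real.log (1 + T))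

lemma clipModulus_nonneg {T : ℝ} (hT : 0 ≤ T) : 0 ≤ clipModulus T := by
  have h1 : 0 ≤ Real.log (1 + T) := Real.log_nonneg (by linarith)
  have h2 : 0 ≤ Real.log (1 + 2 * Real.log (1 + T)) := Real.log_nonneg (by linarith)
  unfold clipModulus
  positivity

lemma exp_le_two_pow {s : ℝ} {n : ℕ} (h : 2 * s ≤ n) : Real.exp s ≤ 2 ^ n := by
  rw [← Real.exp_log (by positivity : (0 : ℝ) < 2 ^ n), Real.exp_le_exp, Real.log_pow]
  nlinarith [Real.log_two_gt_d9, (Nat.cast_nonneg n : (0 : ℝ) ≤ n)]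

lemma formLE_clip_log {T : ℝ} (hT : 0 ≤ T) (hW : FormLE W 1)
    (hxy : FormLE (fun i j => ((x i - y j : ℝ) : ℂ) * W i j) 1) :
    FormLE (fun i j => ((clip T (x i) - clip T (y j) : ℝ) : ℂ) * W i j) (clipModulus T) := by
  have h1 : 0 ≤ Real.log (1 + T) := Real.log_nonneg (by linarith)
  have h2 : 0 ≤ Real.log (1 + 2 * Real.log (1 + T)) := Real.log_nonneg (by linarith)
  set m : ℕ := ⌈2 * Real.log (1 + 2 * Real.log (1 + T))⌉₊ with hm
  have hm1 : 1 + 2 * Real.log (1 + T) ≤ 2 ^ m := by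
    have := exp_le_two_pow (Nat.le_ceil (2 * Real.log (1 + 2 * Real.log (1 + T))))
    rwa [Real.exp_log (by linarith)] at this
  have hm2 : 1 + T ≤ 2 ^ 2 ^ m := by
    have := exp_le_two_pow (s := Real.log (1 + T)) (n := 2 ^ m) (by push_cast; linarith)
    rwa [Real.exp_log (by linarith)] at this
  have hm3 := Nat.ceil_lt_add_one (mul_nonneg zero_le_two h2)
  rw [← hm] at hm3
  exact (formLE_clip hT (by linarith : T ≤ 2 ^ 2 ^ m) hW hxy).mono
    (by unfold clipModulus; linarith)

lemma one_add_log_le {b s t : ℝ} (hb : 0 ≤ b) (hs : 1 ≤ s) (ht : 0 ≤ t) (hbs : b ≤ s * (1 + t)) :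
    Real.log b ≤ Real.log s + t := by
  rcases hb.eq_or_lt with rfl | hb
  · rw [Real.log_zero]; linarith [Real.log_nonneg hs]
  · calc Real.log b ≤ Real.log (s * (1 + t)) := Real.log_le_log hb hbs
      _ = Real.log s + Real.log (1 + t) := Real.log_mul (by linarith) (by linarith)
      _ ≤ Real.log s + t := by linarith [Real.log_le_sub_one_of_pos (by linarith : 0 < 1 + t)]

lemma clipModulus_le {T L : ℝ} (hT : 0 ≤ T) (hL : 0 < L) :
    clipModulus T ≤ clipModulus L + 240 * (T / L) := by
  have h0 : 0 ≤ T / L := by positivity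
  have h1 : 0 ≤ Real.log (1 + T) := Real.log_nonneg (by linarith)
  have h2 : 0 ≤ Real.log (1 + L) := Real.log_nonneg (by linarith)
  have h3 : Real.log (1 + T) ≤ Real.log (1 + L) + T / L := by
    refine one_add_log_le (by linarith) (by linarith) h0 ?_
    have : L * (T / L) = T := by field_simp
    nlinarith
  have h4 : Real.log (1 + 2 * Real.log (1 + T))
      ≤ Real.log (1 + 2 * Real.log (1 + L)) + 2 * (T / L) := by
    refine one_add_log_le (by linarith) (by linarith) (by linarith) ?_
    nlinarith
  unfold clipModulus
  linarith

lemma formLE_clip_scaled {T L δ : ℝ} (hT : 0 ≤ T) (hL : 0 < L) (hδ : 0 < δ) (hW : FormLE W 1)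
    (hxy : FormLE (fun i j => ((x i - y j : ℝ) : ℂ) * W i j) δ) :
    FormLE (fun i j => ((clip T (x i) - clip T (y j) : ℝ) : ℂ) * W i j)
      (δ * clipModulus L + 240 / L * T) := by
  have hδ' : (δ : ℂ) ≠ 0 := Complex.ofReal_ne_zero.2 hδ.ne'
  have h1 : FormLE (fun i j => ((x i / δ - y j / δ : ℝ) : ℂ) * W i j) 1 := by
    have h := hxy.const_mul ((1 / δ : ℝ) : ℂ)
    rw [Complex.norm_real, Real.norm_eq_abs, abs_of_pos (by positivity),
      one_div_mul_cancel hδ.ne'] at h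
    convert h using 3
    push_cast
    ring
  have h2 := (formLE_clip_log (T := T / δ) (by positivity) hW h1).const_mul (δ : ℂ)
  have hclip : ∀ z, clip T z = δ * clip (T / δ) (z / δ) := fun z => by
    rw [← clip_mul hδ.le, mul_div_cancel₀ _ hδ.ne', mul_div_cancel₀ _ hδ.ne']
  rw [Complex.norm_real, Real.norm_eq_abs, abs_of_pos hδ] at h2
  have h3 := mul_le_mul_of_nonneg_left (clipModulus_le (T := T / δ) (by positivity) hL) hδ.le
  have h4 : δ * (clipModulus L + 240 * (T / δ / L)) = δ * clipModulus L + 240 / L * T := by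
    field_simp
  rw [h4] at h3
  convert h2.mono h3 using 3 with i j
  rw [hclip, hclip]
  push_cast
  ring

end Clip

section Concave

/-- A function on the line which is concave on `[0, ∞)` and vanishes on `(-∞, 0]` coincides on
any finite set with a combination of the functions `clip t` with nonnegative coefficients. -/
lemma exists_clip_combination {f : ℝ → ℝ} (hmono : Monotone f) (hzero : ∀ t ≤ (0 : ℝ), f t = 0)
    (hconc : ConcaveOn ℝ (Set.Ici 0) f) {a : ℝ} (ha : 0 ≤ a) (hfa : ∀ t, 0 ≤ t → f t ≤ a * t)
    {P : (ℝ → ℝ) → ℝ → Prop} {α β : ℝ} (hP0 : P (fun _ => 0) 0)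
    (hP : ∀ g c b t, P g c → 0 ≤ b → 0 ≤ t →
      P (fun x => g x + b * clip t x) (c + b * (α + β * t))) (S : Finset ℝ) :
    ∃ (h : ℝ → ℝ) (t σ r s : ℝ), 0 ≤ t ∧ 0 ≤ σ ∧ P h (r * α + s * β) ∧ r + σ = a ∧
      s + σ * t = f t ∧ (t = 0 ∨ t ∈ S) ∧ (∀ x, t ≤ x → h x = h t) ∧ h t + σ * t = f t ∧
      (∀ x ≤ 0, h x = 0) ∧ (∀ x ∈ S, x ≤ t ∧ h x + σ * clip t x = f x) ∧
      ∀ x, t ≤ x → f x - f t ≤ σ * (x - t) := by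
  induction S using Finset.induction_on_max with
  | empty =>
    refine ⟨fun _ => 0, 0, a, 0, 0, le_rfl, ha, by simpa using hP0, by simp,
      by simp [hzero 0 le_rfl], .inl rfl, fun _ _ => rfl, by simp [hzero 0 le_rfl],
      fun _ _ => rfl, by simp, fun x hx => ?_⟩
    simpa [hzero 0 le_rfl] using hfa x hx
  | insert m S hm ih =>
    obtain ⟨h, t, σ, r, s, ht, hσ, hPh, hr, hs, htS, hconst, hht, hneg, hS, hslope⟩ := ih
    rcases le_or_gt m 0 with hm0 | hm0
    · refine ⟨h, t, σ, r, s, ht, hσ, hPh, hr, hs,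
        htS.imp_right (Finset.mem_insert_of_mem ·), hconst, hht, hneg, fun x hx => ?_, hslope⟩
      rcases Finset.mem_insert.1 hx with rfl | hx
      · exact ⟨hm0.trans ht, by rw [hneg _ hm0, clip_of_nonpos hm0, hzero _ hm0]; ring⟩
      · exact hS x hx
    · have htm : t < m := by
        rcases htS with rfl | h'
        · exact hm0
        · exact hm t h'
      set σ' : ℝ := (f m - f t) / (m - t) with hσ'
      have hmt : 0 < m - t := sub_pos.2 htm
      have e : σ' * (m - t) = f m - f t := div_mul_cancel₀ _ hmt.ne'
      have hσ'0 : 0 ≤ σ' := div_nonneg (sub_nonneg.2 (hmono htm.le)) hmt.le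
      have hσ'σ : σ' ≤ σ := by
        rw [hσ', div_le_iff₀ hmt]; exact hslope m htm.le
      have hm' : m ∈ insert m S := Finset.mem_insert_self _ _
      have hnew : (h m + (σ - σ') * clip t m) + σ' * m = f m := by
        rw [clip_of_ge ht htm.le, hconst m htm.le]; linarith
      refine ⟨fun x => h x + (σ - σ') * clip t x, m, σ', r + (σ - σ'), s + (σ - σ') * t, hm0.le,
        hσ'0, ?_, by linarith, by linarith, .inr hm', fun x hx => ?_, hnew, fun x hx => ?_,
        fun x hx => ?_, fun x hx => ?_⟩
      · convert hP h _ (σ - σ') t hPh (sub_nonneg.2 hσ'σ) ht using 1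
        ring
      · dsimp only
        rw [hconst x (htm.le.trans hx), hconst m htm.le, clip_of_ge ht htm.le,
          clip_of_ge ht (htm.le.trans hx)]
      · dsimp only
        rw [hneg x hx, clip_of_nonpos hx]; ring
      · rcases Finset.mem_insert.1 hx with rfl | hx
        · exact ⟨le_rfl, by rw [clip_of_mem (T := x) hm0.le le_rfl]; exact hnew⟩
        · obtain ⟨hxt, hfx⟩ := hS x hx
          have hclip : clip m x = clip t x := by
            rw [clip, clip, min_eq_left hxt, min_eq_left (hxt.trans htm.le)]
          refine ⟨hxt.trans htm.le, ?_⟩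
          rw [hclip]; linarith
      · rcases hx.eq_or_lt with rfl | hmx
        · simp
        · have := hconc.slope_anti_adjacent (x := t) (y := m) (z := x) ht
            (Set.mem_Ici.2 (hm0.le.trans hx)) htm hmx
          rwa [← hσ', div_le_iff₀ (sub_pos.2 hmx)] at this

lemma ConcaveOn.le_mul_of_tendsto_slope {f : ℝ → ℝ} (hconc : ConcaveOn ℝ (Set.Ici 0) f)
    (h0 : f 0 = 0) {a : ℝ}
    (ha : Filter.Tendsto (fun t => f t / t) (nhdsWithin 0 (Set.Ioi 0)) (nhds a)) {x : ℝ}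
    (hx : 0 ≤ x) : f x ≤ a * x := by
  rcases hx.eq_or_lt with rfl | hx
  · simp [h0]
  · rw [← div_le_iff₀ hx]
    refine ge_of_tendsto ha ?_
    filter_upwards [Ioo_mem_nhdsGT hx] with t ht
    have := hconc.2 (Set.mem_Ici.2 le_rfl : (0 : ℝ) ∈ Set.Ici 0) (Set.mem_Ici.2 hx.le)
      (sub_nonneg.2 ((div_le_one hx).2 ht.2.le)) (div_nonneg ht.1.le hx.le)
      (by ring : 1 - t / x + t / x = 1)
    simp only [smul_eq_mul, h0, mul_zero, zero_add] at this
    rw [div_mul_cancel₀ _ hx.ne'] at this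
    rw [le_div_iff₀ ht.1]
    calc f x / x * t = t / x * f x := by ring
      _ ≤ f t := this

lemma formLE_concave {f : ℝ → ℝ} (hmono : Monotone f) (hzero : ∀ t ≤ (0 : ℝ), f t = 0)
    (hconc : ConcaveOn ℝ (Set.Ici 0) f) {a M δ : ℝ} (ha : 0 < a) (hM : 0 < M) (hδ : 0 < δ)
    (hfa : ∀ t, 0 ≤ t → f t ≤ a * t) (hfM : ∀ t, f t ≤ M)
    {ι κ : Type} [Fintype ι] [Fintype κ] {x : ι → ℝ} {y : κ → ℝ} {W : ι → κ → ℂ}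
    (hW : FormLE W 1) (hxy : FormLE (fun i j => ((x i - y j : ℝ) : ℂ) * W i j) δ) :
    FormLE (fun i j => ((f (x i) - f (y j) : ℝ) : ℂ) * W i j)
      (a * δ * (clipModulus (M / (a * δ)) + 240)) := by
  classical
  set L : ℝ := M / (a * δ) with hLdef
  have hL : 0 < L := by positivity
  set P : (ℝ → ℝ) → ℝ → Prop := fun g c =>
    FormLE (fun i j => ((g (x i) - g (y j) : ℝ) : ℂ) * W i j) c with hPdef
  have hP : ∀ g c b t, P g c → 0 ≤ b → 0 ≤ t →
      P (fun x => g x + b * clip t x) (c + b * (δ * clipModulus L + 240 / L * t)) := by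
    intro g c b t hg hb ht
    have h := (formLE_clip_scaled ht hL hδ hW hxy).const_mul (b : ℂ)
    rw [Complex.norm_real, Real.norm_eq_abs, abs_of_nonneg hb] at h
    convert hg.add h using 3
    push_cast
    ring
  obtain ⟨h, t, σ, r, s, ht, hσ, hPh, hr, hs, -, -, -, -, hS, -⟩ :=
    exists_clip_combination hmono hzero hconc ha.le hfa (P := P)
      (by simpa [hPdef] using FormLE.zero le_rfl) hP (Finset.univ.image x ∪ Finset.univ.image y)
  have hfinal := hP h _ σ t hPh hσ ht
  have hx : ∀ i, h (x i) + σ * clip t (x i) = f (x i) := fun i => (hS _ (by simp)).2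
  have hy : ∀ j, h (y j) + σ * clip t (y j) = f (y j) := fun j => (hS _ (by simp)).2
  simp only [hPdef, hx, hy] at hfinal
  refine hfinal.mono ?_
  have e1 : r * (δ * clipModulus L) + s * (240 / L) + σ * (δ * clipModulus L + 240 / L * t)
      = a * δ * clipModulus L + 240 / L * f t := by
    rw [← hr, ← hs]; ring
  have e2 : 240 / L * M = a * δ * 240 := by
    rw [hLdef]; field_simp
  have e3 : 240 / L * f t ≤ 240 / L * M := mul_le_mul_of_nonneg_left (hfM t) (by positivity)
  rw [e1]
  linarith

end Concave

section Operators

variable {H : Type} [NormedAddCommGroup H] [InnerProductSpace ℂ H]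

lemma norm_sum_smul_eq_euclNorm {ι : Type} [Fintype ι] {e : ι → H} (he : Orthonormal ℂ e)
    (u : ι → ℂ) : ‖∑ i, u i • e i‖ = euclNorm u := by
  have h : ‖∑ i, u i • e i‖ ^ 2 = ∑ i, ‖u i‖ ^ 2 := by
    rw [← inner_self_eq_norm_sq (𝕜 := ℂ), he.inner_sum]
    simp [← Complex.normSq_eq_norm_sq, Complex.normSq_apply]
  rw [euclNorm, ← h, Real.sqrt_sq (norm_nonneg _)]

lemma formLE_inner {ι κ : Type} [Fintype ι] [Fintype κ] {e : ι → H} {e' : κ → H}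
    (he : Orthonormal ℂ e) (he' : Orthonormal ℂ e') (T : H →L[ℂ] H) :
    FormLE (fun i j => inner ℂ (e i) (T (e' j))) ‖T‖ := fun u v => by
  have key : ∑ i, ∑ j, u i * inner ℂ (e i) (T (e' j)) * v j
      = inner ℂ (∑ i, star (u i) • e i) (T (∑ j, v j • e' j)) := by
    rw [sum_inner]
    refine Finset.sum_congr rfl fun i _ => ?_
    rw [map_sum, inner_sum]
    refine Finset.sum_congr rfl fun j _ => ?_
    rw [map_smul, inner_smul_left, inner_smul_right, RCLike.star_def, RCLike.conj_conj]
    ring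
  have hu : ‖∑ i, star (u i) • e i‖ = euclNorm u := by
    rw [norm_sum_smul_eq_euclNorm he]; simp [euclNorm]
  rw [key, ← hu, ← norm_sum_smul_eq_euclNorm he']
  calc _ ≤ ‖∑ i, star (u i) • e i‖ * ‖T (∑ j, v j • e' j)‖ := norm_inner_le_norm _ _
    _ ≤ ‖∑ i, star (u i) • e i‖ * (‖T‖ * ‖∑ j, v j • e' j‖) := by gcongr; exact T.le_opNorm _
    _ = _ := by ring

variable [CompleteSpace H]

/-- Diagonalization of the compression of a self-adjoint operator to a finite-dimensional
subspace containing the first `n` iterates of `v`. -/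
lemma exists_compression_basis {A : H →L[ℂ] H} (hA : IsSelfAdjoint A) (K : Submodule ℂ H)
    [FiniteDimensional ℂ K] {v : H} {n : ℕ} (hv : ∀ k ≤ n, (A ^ k) v ∈ K) :
    ∃ (d : ℕ) (e : OrthonormalBasis (Fin d) ℂ K) (x : Fin d → ℝ), (∀ i, |x i| ≤ ‖A‖) ∧
      (∀ i, ∀ w ∈ K, inner ℂ (e i : H) (A w) = x i * inner ℂ (e i : H) w) ∧
      ∀ p : Polynomial ℝ, p.natDegree ≤ n → (Polynomial.aeval A p) v
        = ∑ i, ((p.eval (x i) : ℝ) : ℂ) • (inner ℂ (e i : H) v • (e i : H)) := by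
  have hsymm : ∀ v w, inner ℂ (A v) w = inner ℂ v (A w) := hA.isSymmetric
  let T : K →ₗ[ℂ] K := K.orthogonalProjectionOnto.toLinearMap ∘ₗ A.toLinearMap ∘ₗ K.subtype
  have hT : ∀ w : K, T w = K.orthogonalProjectionOnto (A w) := fun _ => rfl
  have hTsymm : T.IsSymmetric := fun v w => by
    rw [hT, hT, Submodule.inner_orthogonalProjectionOnto_eq_of_mem_right,
      Submodule.inner_orthogonalProjectionOnto_eq_of_mem_left, hsymm]
  set e := hTsymm.eigenvectorBasis rfl with he
  set x := hTsymm.eigenvalues rfl with hx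
  have hTe : ∀ i, T (e i) = (x i : ℂ) • e i := hTsymm.apply_eigenvectorBasis rfl
  have hinner : ∀ i, ∀ w ∈ K, inner ℂ (e i : H) (A w) = x i * inner ℂ (e i : H) w := by
    intro i w hw
    have h1 := Submodule.inner_orthogonalProjectionOnto_eq_of_mem_right (K := K) ⟨w, hw⟩ (A (e i))
    rw [← hT, hTe, Submodule.coe_inner, Submodule.coe_smul, inner_smul_left,
      Complex.conj_ofReal] at h1
    rw [← hsymm]
    exact h1.symm
  have hnorm : ∀ i, ‖(e i : H)‖ = 1 := fun i => e.orthonormal.1 i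
  have hpow : ∀ k ≤ n, (A ^ k) v
      = ∑ i, ((x i ^ k : ℝ) : ℂ) • (inner ℂ (e i : H) v • (e i : H)) := by
    intro k hk
    have hrepr : ((∑ i, inner ℂ (e i) (⟨_, hv k hk⟩ : K) • e i : K) : H) = (A ^ k) v := by
      rw [e.sum_repr']
    rw [← hrepr]
    simp only [AddSubmonoidClass.coe_finsetSum, Submodule.coe_smul]
    refine Finset.sum_congr rfl fun i _ => ?_
    rw [smul_smul]
    congr 1
    rw [Submodule.coe_inner]
    change inner ℂ (e i : H) ((A ^ k) v) = _
    clear hrepr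
    induction k with
    | zero => simp
    | succ k ih =>
      rw [pow_succ', mul_apply_eq_comp, hinner i _ (hv k (by omega)),
        ih (by omega)]
      push_cast
      ring
  refine ⟨_, e, x, fun i => ?_, hinner, fun p hp => ?_⟩
  · have h1 := hinner i (e i) (e i).2
    rw [inner_self_eq_norm_sq_to_K, hnorm] at h1
    have h2 : ‖inner ℂ (e i : H) (A (e i))‖ ≤ ‖(e i : H)‖ * ‖A (e i)‖ := norm_inner_le_norm _ _
    have h3 := A.le_opNorm (e i)
    rw [h1, hnorm] at h2
    rw [hnorm] at h3
    simp at h2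
    linarith
  · rw [Polynomial.aeval_eq_sum_range, sum_apply]
    simp only [Polynomial.eval_eq_sum_range, Complex.ofReal_sum, Finset.sum_smul]
    rw [Finset.sum_comm]
    refine Finset.sum_congr rfl fun k hk => ?_
    rw [smul_apply, hpow k (by have := Finset.mem_range.1 hk; omega),
      Finset.smul_sum]
    refine Finset.sum_congr rfl fun i _ => ?_
    rw [Complex.ofReal_mul, mul_smul]
    exact (Complex.coe_smul _ _).symm

lemma norm_cfc_sub_aeval_le {f : ℝ → ℝ} (hf : Continuous f) {A : H →L[ℂ] H}
    (hA : IsSelfAdjoint A) {p : Polynomial ℝ} {ε : ℝ} (hε : 0 ≤ ε)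
    (hp : ∀ x ∈ Set.Icc (-‖A‖) ‖A‖, |p.eval x - f x| ≤ ε) :
    ‖cfc f A - Polynomial.aeval A p‖ ≤ ε := by
  rw [← cfc_polynomial p A, ← cfc_sub f p.eval A]
  refine norm_cfc_le hε fun x hx => ?_
  have hx' : ‖x‖ ≤ ‖A‖ := IsometricContinuousFunctionalCalculus.norm_spectrum_le A hx
  rw [Real.norm_eq_abs, abs_sub_comm]
  exact hp x (abs_le.1 hx')

/-- Transference of bounds for finite matrices to self-adjoint operators. -/
lemma norm_cfc_sub_cfc_le_of_formLE {f : ℝ → ℝ} (hf : Continuous f) {δ c : ℝ} (hc : 0 ≤ c)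
    (h : ∀ (d d' : ℕ) (x : Fin d → ℝ) (y : Fin d' → ℝ) (W : Fin d → Fin d' → ℂ), FormLE W 1 →
      FormLE (fun i j => ((x i - y j : ℝ) : ℂ) * W i j) δ →
      FormLE (fun i j => ((f (x i) - f (y j) : ℝ) : ℂ) * W i j) c)
    {A B : H →L[ℂ] H} (hA : IsSelfAdjoint A) (hB : IsSelfAdjoint B) (hAB : ‖A - B‖ ≤ δ) :
    ‖cfc f A - cfc f B‖ ≤ c := by
  refine le_of_forall_pos_le_add fun η hη => ?_
  set ε : ℝ := η / 4 with hε
  have hε0 : 0 < ε := by positivity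
  set R : ℝ := max ‖A‖ ‖B‖ with hR
  obtain ⟨p, hp⟩ := exists_polynomial_near_of_continuousOn (-R) R f hf.continuousOn ε hε0
  have hpA : ∀ x, |x| ≤ ‖A‖ → |p.eval x - f x| ≤ ε := fun x hx =>
    (hp x (abs_le.1 (hx.trans (le_max_left _ _)))).le
  have hpB : ∀ x, |x| ≤ ‖B‖ → |p.eval x - f x| ≤ ε := fun x hx =>
    (hp x (abs_le.1 (hx.trans (le_max_right _ _)))).le
  have hA' := norm_cfc_sub_aeval_le hf hA hε0.le fun x hx => hpA x (abs_le.2 hx)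
  have hB' := norm_cfc_sub_aeval_le hf hB hε0.le fun x hx => hpB x (abs_le.2 hx)
  have hmain : ‖Polynomial.aeval A p - Polynomial.aeval B p‖ ≤ c + 2 * ε := by
    refine ContinuousLinearMap.opNorm_le_bound _ (by positivity) fun v => ?_
    set K : Submodule ℂ H := Submodule.span ℂ
      (((fun k => (A ^ k) v) '' Set.Iic p.natDegree) ∪
        ((fun k => (B ^ k) v) '' Set.Iic p.natDegree)) with hK
    have : FiniteDimensional ℂ K := FiniteDimensional.span_of_finite ℂ
      (((Set.finite_Iic _).image _).union ((Set.finite_Iic _).image _))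
    have hKA : ∀ k ≤ p.natDegree, (A ^ k) v ∈ K := fun k hk =>
      Submodule.subset_span (.inl ⟨k, hk, rfl⟩)
    have hKB : ∀ k ≤ p.natDegree, (B ^ k) v ∈ K := fun k hk =>
      Submodule.subset_span (.inr ⟨k, hk, rfl⟩)
    obtain ⟨d, e, x, hx, hxe, hxp⟩ := exists_compression_basis hA K hKA
    obtain ⟨d', e', y, hy, hye, hyp⟩ := exists_compression_basis hB K hKB
    have hvK : v ∈ K := by simpa using hKA 0 (Nat.zero_le _)
    have oe : Orthonormal ℂ (fun i => (e i : H)) := e.orthonormal.comp_linearIsometry K.subtypeₗᵢ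
    have oe' : Orthonormal ℂ (fun i => (e' i : H)) :=
      e'.orthonormal.comp_linearIsometry K.subtypeₗᵢ
    set W : Fin d → Fin d' → ℂ := fun i j => inner ℂ (e i : H) (e' j : H) with hW
    have hW1 : FormLE W 1 := (formLE_inner oe oe' (ContinuousLinearMap.id ℂ H)).mono
      ContinuousLinearMap.norm_id_le
    have hWxy : FormLE (fun i j => ((x i - y j : ℝ) : ℂ) * W i j) δ := by
      convert (formLE_inner oe oe' (A - B)).mono hAB using 3 with i j
      have h1 := hye j (e i) (e i).2
      have h2 : inner ℂ (e i : H) (B (e' j)) = y j * W i j := by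
        rw [← hB.isSymmetric.apply_clm, ← inner_conj_symm, h1, map_mul, Complex.conj_ofReal,
          inner_conj_symm]
      rw [sub_apply, inner_sub_right, h2, hxe i _ (e' j).2]
      push_cast
      ring
    have hWp := hW1.perturb hε0.le (fun i => hpA _ (hx i)) (fun j => hpB _ (hy j))
      (h d d' x y W hW1 hWxy)
    set w : H := (Polynomial.aeval A p - Polynomial.aeval B p) v with hw
    have hwK : w ∈ K := by
      rw [hw, sub_apply, hxp p le_rfl, hyp p le_rfl]
      exact K.sub_mem (K.sum_mem fun i _ => K.smul_mem _ (K.smul_mem _ (e i).2))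
        (K.sum_mem fun i _ => K.smul_mem _ (K.smul_mem _ (e' i).2))
    have parseval : ∀ {r : ℕ} (b : OrthonormalBasis (Fin r) ℂ K) (z : H), z ∈ K →
        ∑ i, inner ℂ (b i : H) z • (b i : H) = z := by
      intro r b z hz
      have := congrArg (Subtype.val) (b.sum_repr' ⟨z, hz⟩)
      push_cast at this
      exact this
    have h1 : ∀ i, inner ℂ (e i : H) v = ∑ j, W i j * inner ℂ (e' j : H) v := fun i => by
      conv_lhs => rw [← parseval e' v hvK]
      simp only [inner_sum, inner_smul_right, hW, mul_comm]
    have h2 : ∀ j, inner ℂ w (e' j : H) = ∑ i, inner ℂ w (e i : H) * W i j := fun j => by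
      conv_lhs => rw [← parseval e (e' j) (e' j).2]
      simp only [inner_sum, inner_smul_right, hW, mul_comm]
    have hsum : inner ℂ w w = ∑ i, ∑ j, inner ℂ w (e i : H) *
        (((p.eval (x i) - p.eval (y j) : ℝ) : ℂ) * W i j) * inner ℂ (e' j : H) v := by
      have hwA : inner ℂ w (Polynomial.aeval A p v) = ∑ i, ∑ j, inner ℂ w (e i : H) *
          (((p.eval (x i) : ℝ) : ℂ) * W i j) * inner ℂ (e' j : H) v := by
        rw [hxp p le_rfl, inner_sum]
        refine Finset.sum_congr rfl fun i _ => ?_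
        rw [inner_smul_right, inner_smul_right, h1, Finset.sum_mul, Finset.mul_sum]
        exact Finset.sum_congr rfl fun j _ => by ring
      have hwB : inner ℂ w (Polynomial.aeval B p v) = ∑ i, ∑ j, inner ℂ w (e i : H) *
          (((p.eval (y j) : ℝ) : ℂ) * W i j) * inner ℂ (e' j : H) v := by
        rw [hyp p le_rfl, inner_sum, Finset.sum_comm]
        refine Finset.sum_congr rfl fun j _ => ?_
        rw [inner_smul_right, inner_smul_right, h2, Finset.mul_sum, Finset.mul_sum]
        exact Finset.sum_congr rfl fun j _ => by ring
      have hww : inner ℂ w w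
          = inner ℂ w (Polynomial.aeval A p v) - inner ℂ w (Polynomial.aeval B p v) := by
        rw [← inner_sub_right]; rfl
      rw [hww, hwA, hwB]
      simp only [← Finset.sum_sub_distrib]
      refine Finset.sum_congr rfl fun i _ => Finset.sum_congr rfl fun j _ => ?_
      push_cast
      ring
    have hnorm_v : euclNorm (fun j => inner ℂ (e' j : H) v) = ‖v‖ := by
      rw [← norm_sum_smul_eq_euclNorm oe', parseval e' v hvK]
    have hnorm_w : euclNorm (fun i => inner ℂ w (e i : H)) = ‖w‖ := by
      have : euclNorm (fun i => inner ℂ w (e i : H)) = euclNorm fun i => inner ℂ (e i : H) w := by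
        simp only [euclNorm, norm_inner_symm w]
      rw [this, ← norm_sum_smul_eq_euclNorm oe, parseval e w hwK]
    have hle := hWp (fun i => inner ℂ w (e i : H)) (fun j => inner ℂ (e' j : H) v)
    rw [← hsum, hnorm_v, hnorm_w, inner_self_eq_norm_sq_to_K, norm_pow, RCLike.norm_ofReal, abs_norm,
      sq] at hle
    rcases (norm_nonneg w).eq_or_lt with h0 | h0
    · rw [← h0]; positivity
    · refine le_of_mul_le_mul_left (hle.trans_eq ?_) h0
      ring
  calc ‖cfc f A - cfc f B‖
      = ‖(cfc f A - Polynomial.aeval A p) + (Polynomial.aeval A p - Polynomial.aeval B p)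
        - (cfc f B - Polynomial.aeval B p)‖ := by congr 1; abel
    _ ≤ ε + (c + 2 * ε) + ε :=
      (norm_sub_le _ _).trans (add_le_add ((norm_add_le _ _).trans (add_le_add hA' hmain)) hB')
    _ = c + η := by rw [hε]; ring

end Operators

lemma exists_clipModulus_le_log_log : ∃ C : ℝ, 0 < C ∧ ∀ L : ℝ, 3 < L →
    clipModulus L + 240 ≤ C * Real.log (Real.log L) := by
  have h3 : 1 < Real.log 3 := by
    rw [Real.lt_log_iff_exp_lt (by norm_num)]
    exact Real.exp_one_lt_d9.trans (by norm_num)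
  have hκ : 0 < Real.log (Real.log 3) := Real.log_pos h3
  refine ⟨120 + 619 / Real.log (Real.log 3), by positivity, fun L hL => ?_⟩
  have hlog : Real.log 3 < Real.log L := Real.log_lt_log (by norm_num) hL
  have hloglog : Real.log (Real.log 3) ≤ Real.log (Real.log L) :=
    Real.log_le_log (by linarith) hlog.le
  have h1 : Real.log (1 + L) ≤ 2 * Real.log L := by
    rw [← Real.log_rpow (by linarith), Real.rpow_two]
    exact Real.log_le_log (by linarith) (by nlinarith)
  have h2 : Real.log (1 + 2 * Real.log (1 + L)) ≤ Real.log (Real.log L) + 2 := by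
    have h0 : 0 ≤ Real.log (1 + L) := Real.log_nonneg (by linarith)
    have h5 : Real.log 5 ≤ 2 := by
      rw [Real.log_le_iff_le_exp (by norm_num)]
      have := Real.exp_one_gt_d9
      have e : Real.exp 2 = Real.exp 1 * Real.exp 1 := by rw [← Real.exp_add]; norm_num
      nlinarith
    calc Real.log (1 + 2 * Real.log (1 + L)) ≤ Real.log (5 * Real.log L) :=
          Real.log_le_log (by linarith) (by linarith)
      _ = Real.log 5 + Real.log (Real.log L) := Real.log_mul (by norm_num) (by linarith)
      _ ≤ _ := by linarith
  have h4 : 619 ≤ 619 / Real.log (Real.log 3) * Real.log (Real.log L) := by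
    rw [div_mul_eq_mul_div, le_div_iff₀ hκ]
    linarith
  unfold clipModulus
  linarith

theorem stmt8 :
    ∃ C : ℝ, 0 < C ∧
      ∀ f : ℝ → ℝ, Continuous f → Monotone f → (∀ t ≤ (0 : ℝ), f t = 0) →
        ConcaveOn ℝ (Set.Ici 0) f →
        ∀ M a : ℝ, 0 < M → 0 < a →
          IsLUB (Set.range f) M →
          Filter.Tendsto (fun t => f t / t) (nhdsWithin 0 (Set.Ioi 0)) (nhds a) →
          ∀ δ : ℝ, 0 < δ → δ < M / (3 * a) →
          ∀ (H : Type) [NormedAddCommGroup H] [InnerProductSpace ℂ H] [CompleteSpace H]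
            (A B : H →L[ℂ] H), IsSelfAdjoint A → IsSelfAdjoint B → ‖A - B‖ ≤ δ →
            ‖cfc f A - cfc f B‖ ≤ C * a * δ * Real.log (Real.log (M / (a * δ))) := by
  obtain ⟨C, hC, hCL⟩ := exists_clipModulus_le_log_log
  refine ⟨C, hC, fun f hf hmono hzero hconc M a hM ha hsup hder δ hδ hδM H _ _ _ A B hA hB hAB => ?_⟩
  have hL : 3 < M / (a * δ) := by
    rw [lt_div_iff₀ (by positivity)] at hδM ⊢
    linarith
  have hfa : ∀ t, 0 ≤ t → f t ≤ a * t := fun t ht =>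
    hconc.le_mul_of_tendsto_slope (hzero 0 le_rfl) hder ht
  have hfM : ∀ t, f t ≤ M := fun t => hsup.1 ⟨t, rfl⟩
  have hmod : 0 ≤ clipModulus (M / (a * δ)) := clipModulus_nonneg (by positivity)
  calc ‖cfc f A - cfc f B‖ ≤ a * δ * (clipModulus (M / (a * δ)) + 240) :=
        norm_cfc_sub_cfc_le_of_formLE hf (by positivity)
          (fun d d' x y W hW hxy => formLE_concave hmono hzero hconc ha hM hδ hfa hfM hW hxy)
          hA hB hAB
    _ ≤ a * δ * (C * Real.log (Real.log (M / (a * δ)))) :=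
        mul_le_mul_of_nonneg_left (hCL _ hL) (by positivity)
    _ = C * a * δ * Real.log (Real.log (M / (a * δ))) := by ring
end
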